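/- arXiv:0804.2190 — 14 statements merged into one kernel-verified Lean document; each statement's English description precedes it below -/
import Mathlib

section
/- Let (ℤ, b, 𝒟) be a pre-number system with dynamic mapping T and attractor 𝒜 (the set of T-periodic points). Then (ℤ, b, 𝒟) is a number system if and only if 0 ∈ 𝒜 and every element of 𝒜 lies on the cycle of 0, i.e., for every a ∈ 𝒜 there exists i ≥ 0 with T^i(0) = a. -/
def IsExpansion (b : ℤ) (D : Finset ℤ) (a : ℤ) (ℓ : ℕ) (f : ℕ → ℤ) : Prop :=
  1 ≤ ℓ ∧ (∀ i < ℓ, f i ∈ D) ∧ a = ∑ i ∈ Finset.range ℓ, f i * b ^ i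

def IsNumberSystem (b : ℤ) (D : Finset ℤ) : Prop :=
  ∀ a : ℤ, ∃ ℓ : ℕ, ∃ f : ℕ → ℤ, IsExpansion b D a ℓ f

/-- The attractor of the dynamic mapping `T`: the set of `T`-periodic points. -/
def attractor (T : ℤ → ℤ) : Set ℤ :=
  {a : ℤ | ∃ n : ℕ, 1 ≤ n ∧ T^[n] a = a}

theorem digit_eq_of_dvd_sub {b : ℤ} {D : Finset ℤ} (hb : b ≠ 0) (hcard : D.card = b.natAbs)
    (hcover : ∀ a : ℤ, ∃ d ∈ D, b ∣ a - d) {d e : ℤ} (hd : d ∈ D) (he : e ∈ D)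
    (h : b ∣ d - e) : d = e := by
  have himage : D.image (· % b) = Finset.Ico 0 |b| := by
    ext r
    simp only [Finset.mem_image, Finset.mem_Ico]
    constructor
    · rintro ⟨x, -, rfl⟩
      exact ⟨Int.emod_nonneg _ hb, Int.emod_lt_abs _ hb⟩
    · rintro ⟨h0, h1⟩
      obtain ⟨x, hx, hdvd⟩ := hcover r
      refine ⟨x, hx, ?_⟩
      rw [Int.emod_eq_emod_iff_emod_sub_eq_zero.mpr (Int.emod_eq_zero_of_dvd
        ((dvd_sub_comm).mp hdvd)), ← Int.emod_abs, Int.emod_eq_of_lt h0 h1]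
  have hinj : Set.InjOn (· % b) (D : Set ℤ) := by
    apply Finset.card_image_iff.mp
    rw [himage, Int.card_Ico, hcard, sub_zero, Int.abs_eq_natAbs, Int.toNat_natCast]
  exact hinj hd he (Int.emod_eq_emod_iff_emod_sub_eq_zero.mpr (Int.emod_eq_zero_of_dvd h))

theorem eq_sum_digits_add {b : ℤ} {dig T : ℤ → ℤ} (hT : ∀ a, b * T a = a - dig a)
    (a : ℤ) (n : ℕ) :
    a = ∑ i ∈ Finset.range n, dig (T^[i] a) * b ^ i + b ^ n * T^[n] a := by
  induction n with
  | zero => simp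
  | succ n ih =>
    rw [Finset.sum_range_succ, Function.iterate_succ_apply']
    linear_combination ih - b ^ n * hT (T^[n] a)

theorem iterate_eq_zero_of_isExpansion {b : ℤ} {D : Finset ℤ} (hb : b ≠ 0)
    (hcard : D.card = b.natAbs) (hcover : ∀ a : ℤ, ∃ d ∈ D, b ∣ a - d)
    {dig T : ℤ → ℤ} (hdig : ∀ a, dig a ∈ D ∧ b ∣ a - dig a)
    (hT : ∀ a, b * T a = a - dig a) (n : ℕ) (f : ℕ → ℤ) (hf : ∀ i < n, f i ∈ D) :
    T^[n] (∑ i ∈ Finset.range n, f i * b ^ i) = 0 := by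
  induction n generalizing f with
  | zero => simp
  | succ n ih =>
    set a := ∑ i ∈ Finset.range (n + 1), f i * b ^ i with ha
    set c := ∑ i ∈ Finset.range n, f (i + 1) * b ^ i with hc
    have hac : a = b * c + f 0 := by
      rw [ha, hc, Finset.sum_range_succ', Finset.mul_sum]
      simp only [pow_zero, mul_one]
      congr 1
      exact Finset.sum_congr rfl fun i _ => by ring
    have hd : dig a = f 0 := by
      refine digit_eq_of_dvd_sub hb hcard hcover (hdig a).1 (hf 0 n.succ_pos) ?_
      have h : dig a - f 0 = b * c - (a - dig a) := by linear_combination hac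
      exact h ▸ dvd_sub (dvd_mul_right b c) (hdig a).2
    have hTa : T a = c := mul_left_cancel₀ hb (by rw [hT, hd, hac]; ring)
    rw [Function.iterate_succ_apply, hTa]
    exact ih (fun i => f (i + 1)) fun i hi => hf (i + 1) (by omega)

theorem exists_isExpansion_iff_exists_iterate_eq_zero {b : ℤ} {D : Finset ℤ} (hb : b ≠ 0)
    (hcard : D.card = b.natAbs) (hcover : ∀ a : ℤ, ∃ d ∈ D, b ∣ a - d)
    {dig T : ℤ → ℤ} (hdig : ∀ a, dig a ∈ D ∧ b ∣ a - dig a)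
    (hT : ∀ a, b * T a = a - dig a) (a : ℤ) :
    (∃ n f, IsExpansion b D a n f) ↔ ∃ n, 1 ≤ n ∧ T^[n] a = 0 := by
  constructor
  · rintro ⟨n, f, hn, hf, rfl⟩
    exact ⟨n, hn, iterate_eq_zero_of_isExpansion hb hcard hcover hdig hT n f hf⟩
  · rintro ⟨n, hn, h⟩
    refine ⟨n, fun i => dig (T^[i] a), hn, fun i _ => (hdig _).1, ?_⟩
    simpa [h] using eq_sum_digits_add hT a n

theorem exists_iterate_mem_attractor {b : ℤ} {D : Finset ℤ} (hb : 2 ≤ |b|)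
    {dig T : ℤ → ℤ} (hdig : ∀ a, dig a ∈ D) (hT : ∀ a, b * T a = a - dig a) (a : ℤ) :
    ∃ i, T^[i] a ∈ attractor T := by
  obtain ⟨M, hM⟩ : ∃ M : ℤ, ∀ d ∈ D, |d| ≤ M :=
    ⟨∑ d ∈ D, |d|, fun d hd => Finset.single_le_sum (fun x _ => abs_nonneg x) hd⟩
  have hbound : ∀ i, |T^[i] a| ≤ max |a| M := by
    intro i
    induction i with
    | zero => simp
    | succ i ih =>
      rw [Function.iterate_succ_apply']
      set x := T^[i] a
      have h1 : |b| * |T x| ≤ |x| + |dig x| := by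
        rw [← abs_mul, hT]
        exact abs_sub _ _
      have h2 := (hM _ (hdig x)).trans (le_max_right |a| M)
      nlinarith [abs_nonneg (T x)]
  have hfin : (Set.Icc (-(max |a| M)) (max |a| M)).Finite := Set.finite_Icc _ _
  obtain ⟨i, j, hij, h⟩ := hfin.exists_lt_map_eq_of_forall_mem
    (f := fun i => T^[i] a) fun i => abs_le.mp (hbound i)
  refine ⟨i, j - i, by omega, ?_⟩
  rw [← Function.iterate_add_apply, Nat.sub_add_cancel hij.le]
  exact h.symm

theorem exists_iterate_iterate_eq_self {α : Type*} {T : α → α} {x : α} {n : ℕ} (hn : 1 ≤ n)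
    (h : T^[n] x = x) (k : ℕ) : ∃ m, T^[m] (T^[k] x) = x := by
  refine ⟨n * k - k, ?_⟩
  rw [← Function.iterate_add_apply, Nat.sub_add_cancel (Nat.le_mul_of_pos_left k hn)]
  exact Function.IsPeriodicPt.mul_const (show Function.IsPeriodicPt T n x from h) k

theorem numberSystem_iff_attractor_single_cycle_through_zero
    (b : ℤ) (D : Finset ℤ) (hb : 2 ≤ |b|)
    (hcard : D.card = b.natAbs)
    (hcover : ∀ a : ℤ, ∃ d ∈ D, b ∣ a - d)
    (dig : ℤ → ℤ) (hdig : ∀ a : ℤ, dig a ∈ D ∧ b ∣ a - dig a)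
    (T : ℤ → ℤ) (hT : ∀ a : ℤ, b * T a = a - dig a) :
    IsNumberSystem b D ↔
      (0 ∈ attractor T ∧ ∀ a ∈ attractor T, ∃ i : ℕ, T^[i] 0 = a) := by
  have hb0 : b ≠ 0 := by
    rintro rfl
    simp at hb
  have hiff := exists_isExpansion_iff_exists_iterate_eq_zero hb0 hcard hcover hdig hT
  simp only [IsNumberSystem, hiff]
  constructor
  · refine fun h => ⟨h 0, ?_⟩
    rintro a ⟨n, hn, ha⟩
    obtain ⟨k, -, hk⟩ := h a
    simpa only [hk] using exists_iterate_iterate_eq_self hn ha k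
  · rintro ⟨⟨n, hn, h0⟩, hcycle⟩ a
    obtain ⟨i, hi⟩ := exists_iterate_mem_attractor hb (fun x => (hdig x).1) hT a
    obtain ⟨k, hk⟩ := hcycle _ hi
    obtain ⟨m, hm⟩ := exists_iterate_iterate_eq_self hn h0 k
    refine ⟨n + (m + i), by omega, ?_⟩
    rw [Function.iterate_add_apply, Function.iterate_add_apply, ← hk, hm, h0]
end

section
/- Let (ℤ, b, 𝒟) be a number system. Then 𝒟 contains no nonzero multiple of 1 − b; in particular, |1 − b| ≠ 1 (so b ≠ 2 and b ≠ 0). -/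
/-- A set of `|b|` integers that meets every residue class modulo `b` meets each of them once. -/
theorem eq_of_dvd_sub_of_covers {b : ℤ} {D : Finset ℤ}
    (hcard : D.card = b.natAbs) (hcover : ∀ a : ℤ, ∃ d ∈ D, b ∣ a - d)
    {d e : ℤ} (hd : d ∈ D) (he : e ∈ D) (h : b ∣ d - e) : d = e := by
  have hsub : Finset.Ico 0 |b| ⊆ D.image (· % b) := by
    intro r hr
    obtain ⟨h0, h1⟩ := Finset.mem_Ico.mp hr
    obtain ⟨c, hc, hdvd⟩ := hcover r
    refine Finset.mem_image.mpr ⟨c, hc, ?_⟩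
    have hrc : r % b = c % b := Int.emod_eq_emod_iff_emod_sub_eq_zero.mpr
      (Int.emod_eq_zero_of_dvd hdvd)
    rw [← hrc, ← Int.emod_abs, Int.emod_eq_of_lt h0 h1]
  have hle := Finset.card_le_card hsub
  have hinj : Set.InjOn (· % b) (D : Set ℤ) := by
    refine Finset.card_image_iff.mp (le_antisymm Finset.card_image_le ?_)
    rw [Int.card_Ico, sub_zero, Int.abs_eq_natAbs, Int.toNat_natCast] at hle
    exact hcard.trans_le hle
  exact hinj hd he (Int.emod_eq_emod_iff_emod_sub_eq_zero.mpr (Int.emod_eq_zero_of_dvd h))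

/-- A fixed point of the digit-stripping map that is a finite digit sum must vanish. -/
theorem eq_zero_of_eq_digit_sum {b : ℤ} {D : Finset ℤ} (hb : b ≠ 0)
    (hcard : D.card = b.natAbs) (hcover : ∀ a : ℤ, ∃ d ∈ D, b ∣ a - d)
    {k : ℤ} (hk : (1 - b) * k ∈ D) (ℓ : ℕ) (f : ℕ → ℤ) (hf : ∀ i < ℓ, f i ∈ D)
    (h : k = ∑ i ∈ Finset.range ℓ, f i * b ^ i) : k = 0 := by
  induction ℓ generalizing f with
  | zero => simpa using h
  | succ n ih =>
    have hsum : k = b * ∑ i ∈ Finset.range n, f (i + 1) * b ^ i + f 0 := by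
      rw [h, Finset.sum_range_succ', Finset.mul_sum, pow_zero, mul_one]
      congr 1
      exact Finset.sum_congr rfl fun i _ => by ring
    have hdigit : (1 - b) * k = f 0 :=
      eq_of_dvd_sub_of_covers hcard hcover hk (hf 0 n.succ_pos)
        ⟨∑ i ∈ Finset.range n, f (i + 1) * b ^ i - k, by linear_combination hsum⟩
    exact ih (fun i => f (i + 1)) (fun i hi => hf _ (Nat.succ_lt_succ hi))
      (mul_left_cancel₀ hb (by linear_combination hsum - hdigit))

theorem no_nonzero_multiple_of_one_sub_base
    (b : ℤ) (D : Finset ℤ) (hb : 2 ≤ |b|)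
    (hcard : D.card = b.natAbs)
    (hcover : ∀ a : ℤ, ∃ d ∈ D, b ∣ a - d)
    (hns : IsNumberSystem b D) :
    (∀ d ∈ D, (1 - b) ∣ d → d = 0) ∧ |1 - b| ≠ 1 := by
  have hb0 : b ≠ 0 := by
    rintro rfl
    simp at hb
  have hzero : ∀ d ∈ D, (1 - b) ∣ d → d = 0 := by
    rintro _ hd ⟨k, rfl⟩
    obtain ⟨ℓ, f, -, hf, hsum⟩ := hns k
    rw [eq_zero_of_eq_digit_sum hb0 hcard hcover hd ℓ f hf hsum, mul_zero]
  refine ⟨hzero, fun hunit => ?_⟩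
  have hsub : D ⊆ {0} := fun d hd => Finset.mem_singleton.mpr
    (hzero d hd (Int.isUnit_iff_abs_eq.mpr hunit).dvd)
  have hle := Finset.card_le_card hsub
  rw [Finset.card_singleton] at hle
  rw [Int.abs_eq_natAbs] at hb
  omega
end

section
/- Let (ℤ, b, 𝒟) be a pre-number system with dynamic mapping T, let K = max_{d ∈ 𝒟} |d|, and let a ∈ ℤ. Then: (i) if |a|·(|b| − 1) > K then |T(a)| < |a|; (ii) if |a|·(|b| − 1) ≤ K then |T(a)|·(|b| − 1) ≤ K. -/
theorem contraction_bound
    (b : ℤ) (D : Finset ℤ) (hb : 2 ≤ |b|)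
    (hcard : D.card = b.natAbs)
    (hcover : ∀ a : ℤ, ∃ d ∈ D, b ∣ a - d)
    (dig : ℤ → ℤ) (hdig : ∀ a : ℤ, dig a ∈ D ∧ b ∣ a - dig a)
    (T : ℤ → ℤ) (hT : ∀ a : ℤ, b * T a = a - dig a)
    (K : ℤ) (hK₁ : ∀ d ∈ D, |d| ≤ K) (hK₂ : ∃ d ∈ D, |d| = K)
    (a : ℤ) :
    (K < |a| * (|b| - 1) → |T a| < |a|) ∧
    (|a| * (|b| - 1) ≤ K → |T a| * (|b| - 1) ≤ K) := by
  have hb₀ : 0 < |b| := by linarith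
  have key : |b| * |T a| ≤ |a| + K := by
    rw [← abs_mul, hT a]
    exact (abs_sub _ _).trans (by gcongr; exact hK₁ _ (hdig a).1)
  constructor
  · intro h
    refine lt_of_mul_lt_mul_left ?_ hb₀.le
    linarith
  · intro h
    refine le_of_mul_le_mul_left ?_ hb₀
    calc |b| * (|T a| * (|b| - 1)) = |b| * |T a| * (|b| - 1) := by ring
      _ ≤ (|a| + K) * (|b| - 1) := mul_le_mul_of_nonneg_right key (by linarith)
      _ ≤ |b| * K := by linarith
end

section
/- Let (ℤ, b, 𝒟) be a pre-number system with dynamic mapping T and attractor 𝒜, and let n ≥ 1 be an integer. Let 𝒟ⁿ = { Σ_{i=0}^{n−1} d_i b^i : d_0, …, d_{n−1} ∈ 𝒟 } be the n-fold digit set, so that (ℤ, bⁿ, 𝒟ⁿ) is a pre-number system. Then: (i) the dynamic mapping of (ℤ, bⁿ, 𝒟ⁿ) equals the n-fold iterate Tⁿ; (ii) the attractor of (ℤ, bⁿ, 𝒟ⁿ) equals 𝒜; (iii) (ℤ, bⁿ, 𝒟ⁿ) is a number system if and only if (ℤ, b, 𝒟) is a number system and gcd(n, |𝒜|) = 1,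 where |𝒜| is the (finite) cardinality of the attractor. -/
theorem injOn_residues_of_card_le {b : ℤ} {D : Finset ℤ} (hb : b ≠ 0)
    (hcard : D.card ≤ b.natAbs) (hcover : ∀ a : ℤ, ∃ d ∈ D, b ∣ a - d)
    {d e : ℤ} (hd : d ∈ D) (he : e ∈ D) (h : b ∣ d - e) : d = e := by
  have hmaps : Set.MapsTo (fun x : ℤ => x % b) D (Finset.Ico 0 |b|) := fun x _ => by
    simpa using ⟨Int.emod_nonneg x hb, Int.emod_lt_abs x hb⟩
  have hsurj : Set.SurjOn (fun x : ℤ => x % b) D (Finset.Ico 0 |b|) := fun r hr => by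
    simp only [Finset.coe_Ico, Set.mem_Ico] at hr
    obtain ⟨d, hd, hdvd⟩ := hcover r
    refine ⟨d, hd, ?_⟩
    have h1 : r % b = d % b :=
      Int.emod_eq_emod_iff_emod_sub_eq_zero.2 (Int.emod_eq_zero_of_dvd hdvd)
    have h2 : r % b = r := by
      rw [← Int.emod_abs]
      exact Int.emod_eq_of_lt hr.1 hr.2
    exact h1.symm.trans h2
  refine Finset.injOn_of_surjOn_of_card_le _ hmaps hsurj ?_ hd he ?_
  · rwa [Int.card_Ico, Int.abs_eq_natAbs, sub_zero, Int.toNat_natCast]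
  · exact Int.emod_eq_emod_iff_emod_sub_eq_zero.2 (Int.emod_eq_zero_of_dvd h)

theorem iterate_digit_sum_add {b : ℤ} {D : Finset ℤ} {T : ℤ → ℤ}
    (hT : ∀ d ∈ D, ∀ c, T (d + b * c) = c) (n : ℕ) (f : ℕ → ℤ) (hf : ∀ i < n, f i ∈ D) (c : ℤ) :
    T^[n] (∑ i ∈ Finset.range n, f i * b ^ i + b ^ n * c) = c := by
  induction n generalizing f with
  | zero => simp
  | succ n ih =>
    have h : ∑ i ∈ Finset.range (n + 1), f i * b ^ i + b ^ (n + 1) * c =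
        f 0 + b * (∑ i ∈ Finset.range n, f (i + 1) * b ^ i + b ^ n * c) := by
      rw [Finset.sum_range_succ', mul_add, Finset.mul_sum]
      have : ∀ i, f (i + 1) * b ^ (i + 1) = b * (f (i + 1) * b ^ i) := fun i => by ring
      simp only [this]
      ring
    rw [h, Function.iterate_succ_apply, hT _ (hf 0 n.succ_pos)]
    exact ih (fun i => f (i + 1)) fun i hi => hf (i + 1) (by lia)

theorem eq_digit_sum_add_iterate {b : ℤ} {T dig : ℤ → ℤ} (hT : ∀ a, b * T a = a - dig a)
    (n : ℕ) (a : ℤ) :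
    a = ∑ i ∈ Finset.range n, dig (T^[i] a) * b ^ i + b ^ n * T^[n] a := by
  induction n with
  | zero => simp
  | succ n ih =>
    rw [Finset.sum_range_succ, Function.iterate_succ_apply']
    linear_combination ih - b ^ n * hT (T^[n] a)

theorem isNumberSystem_iff_iterate_eq_zero {b : ℤ} {D : Finset ℤ} {T dig : ℤ → ℤ}
    (hdig : ∀ a, dig a ∈ D) (hT : ∀ a, b * T a = a - dig a)
    (hT' : ∀ d ∈ D, ∀ c, T (d + b * c) = c) :
    IsNumberSystem b D ↔ ∀ a, ∃ l, 1 ≤ l ∧ T^[l] a = 0 := by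
  refine forall_congr' fun a => exists_congr fun l => ⟨?_, ?_⟩
  · rintro ⟨f, hl, hf, rfl⟩
    exact ⟨hl, by simpa using iterate_digit_sum_add hT' l f hf 0⟩
  · rintro ⟨hl, h⟩
    refine ⟨fun i => dig (T^[i] a), hl, fun i _ => hdig _, ?_⟩
    simpa [h] using eq_digit_sum_add_iterate hT l a

theorem attractor_iterate (T : ℤ → ℤ) {n : ℕ} (hn : 1 ≤ n) :
    attractor T^[n] = attractor T := by
  ext a
  constructor
  · rintro ⟨m, hm, h⟩
    exact ⟨n * m, Nat.mul_pos hn hm, by rwa [Function.iterate_mul]⟩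
  · rintro ⟨m, hm, h⟩
    refine ⟨m, hm, ?_⟩
    rw [← Function.iterate_mul, mul_comm, Function.iterate_mul]
    exact Function.iterate_fixed h n

theorem ncard_attractor_eq_minimalPeriod {T : ℤ → ℤ} {x : ℤ}
    (h : ∀ a, ∃ l, 1 ≤ l ∧ T^[l] a = x) :
    (attractor T).ncard = Function.minimalPeriod T x := by
  obtain ⟨l, hl, hlx⟩ := h x
  have hp : 0 < Function.minimalPeriod T x :=
    Function.IsPeriodicPt.minimalPeriod_pos hl hlx
  have himage : attractor T = (fun i => T^[i] x) '' Set.Iio (Function.minimalPeriod T x) := by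
    ext a
    constructor
    · rintro ⟨m, hm, ha⟩
      obtain ⟨k, -, hk⟩ := h a
      have hak : T^[m * k - k] x = a := by
        rw [← hk, ← Function.iterate_add_apply, Nat.sub_add_cancel (Nat.le_mul_of_pos_left k hm),
          Function.iterate_mul]
        exact Function.iterate_fixed ha k
      exact ⟨_, Nat.mod_lt _ hp, by simpa only [Function.iterate_mod_minimalPeriod_eq] using hak⟩
    · rintro ⟨i, -, rfl⟩
      refine ⟨_, hp, ?_⟩
      simp only [← Function.iterate_add_apply]
      rw [add_comm, Function.iterate_add_apply, Function.iterate_minimalPeriod]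
  rw [himage, Set.InjOn.ncard_image Function.iterate_injOn_Iio_minimalPeriod]
  simp [Set.ncard_eq_toFinset_card']

theorem forall_iterate_iterate_eq_iff {T : ℤ → ℤ} {x : ℤ} {n : ℕ} (hn : 1 ≤ n) :
    (∀ a, ∃ l, 1 ≤ l ∧ (T^[n])^[l] a = x) ↔
      (∀ a, ∃ l, 1 ≤ l ∧ T^[l] a = x) ∧ Nat.gcd n (attractor T).ncard = 1 := by
  constructor
  · intro h
    have h' : ∀ a, ∃ l, 1 ≤ l ∧ T^[l] a = x := fun a => by
      obtain ⟨l, hl, hx⟩ := h a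
      exact ⟨n * l, Nat.mul_pos hn hl, by rwa [Function.iterate_mul]⟩
    refine ⟨h', ?_⟩
    rw [ncard_attractor_eq_minimalPeriod h']
    obtain ⟨l, -, hx⟩ := h (T x)
    rw [← Function.iterate_mul, ← Function.iterate_succ_apply] at hx
    have hdvd : Function.minimalPeriod T x ∣ n * l + 1 :=
      Function.IsPeriodicPt.minimalPeriod_dvd hx
    refine Nat.dvd_one.1 ((Nat.dvd_add_right ?_).1 ((Nat.gcd_dvd_right _ _).trans hdvd))
    exact (Nat.gcd_dvd_left _ _).mul_right l
  · rintro ⟨h, hgcd⟩ a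
    rw [ncard_attractor_eq_minimalPeriod h] at hgcd
    obtain ⟨k, hk, hx⟩ := h a
    obtain ⟨r, hrn, hrp⟩ := Nat.chineseRemainder hgcd 0 k
    obtain ⟨l, hl⟩ : n ∣ r + n * Function.minimalPeriod T x * k :=
      (Nat.modEq_zero_iff_dvd.1 hrn).add ⟨Function.minimalPeriod T x * k, by ring⟩
    obtain ⟨p₀, hp₀, hpx⟩ := h x
    have hp : 0 < Function.minimalPeriod T x :=
      Function.IsPeriodicPt.minimalPeriod_pos hp₀ hpx
    have hge : k ≤ n * l := by
      rw [← hl]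
      exact (Nat.le_mul_of_pos_left k (Nat.mul_pos hn hp)).trans (Nat.le_add_left _ _)
    have hmod : k ≡ n * l [MOD Function.minimalPeriod T x] := by
      rw [← hl]
      refine hrp.symm.trans ?_
      rw [Nat.modEq_iff_dvd' (Nat.le_add_right _ _), Nat.add_sub_cancel_left]
      exact ⟨n * k, by ring⟩
    refine ⟨l, Nat.pos_of_ne_zero ?_, ?_⟩
    · rintro rfl
      lia
    · rw [← Function.iterate_mul, ← Nat.sub_add_cancel hge, Function.iterate_add_apply, hx]
      exact (Function.isPeriodicPt_iff_minimalPeriod_dvd.2 ((Nat.modEq_iff_dvd' hge).1 hmod))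

theorem nfold_number_system
    (b : ℤ) (D : Finset ℤ) (hb : 2 ≤ |b|)
    (hcard : D.card = b.natAbs)
    (hcover : ∀ a : ℤ, ∃ d ∈ D, b ∣ a - d)
    (dig : ℤ → ℤ) (hdig : ∀ a : ℤ, dig a ∈ D ∧ b ∣ a - dig a)
    (T : ℤ → ℤ) (hT : ∀ a : ℤ, b * T a = a - dig a)
    (n : ℕ) (hn : 1 ≤ n)
    (Dn : Finset ℤ)
    (hDn : ∀ x : ℤ, x ∈ Dn ↔
      ∃ f : ℕ → ℤ, (∀ i < n, f i ∈ D) ∧ x = ∑ i ∈ Finset.range n, f i * b ^ i)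
    (dign : ℤ → ℤ) (hdign : ∀ a : ℤ, dign a ∈ Dn ∧ b ^ n ∣ a - dign a)
    (Tn : ℤ → ℤ) (hTn : ∀ a : ℤ, b ^ n * Tn a = a - dign a) :
    (∀ a : ℤ, Tn a = T^[n] a) ∧
    attractor Tn = attractor T ∧
    (IsNumberSystem (b ^ n) Dn ↔
      IsNumberSystem b D ∧ Nat.gcd n (attractor T).ncard = 1) := by
  have hb0 : b ≠ 0 := by
    rintro rfl
    simp at hb
  have hstep : ∀ d ∈ D, ∀ c, T (d + b * c) = c := fun d hd c => by
    have hdvd : b ∣ d - dig (d + b * c) := by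
      have h := dvd_sub (hdig (d + b * c)).2 (dvd_mul_right b c)
      rwa [show d + b * c - dig (d + b * c) - b * c = d - dig (d + b * c) by ring] at h
    have heq := injOn_residues_of_card_le hb0 hcard.le hcover hd (hdig _).1 hdvd
    apply mul_left_cancel₀ hb0
    linear_combination hT (d + b * c) + heq
  have hstepn : ∀ d ∈ Dn, ∀ c, T^[n] (d + b ^ n * c) = c := fun d hd c => by
    obtain ⟨f, hf, rfl⟩ := (hDn d).1 hd
    exact iterate_digit_sum_add hstep n f hf c
  have hiter : Tn = T^[n] := funext fun a => by
    have h := hstepn (dign a) (hdign a).1 (Tn a)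
    rwa [hTn, add_sub_cancel, eq_comm] at h
  subst hiter
  refine ⟨fun _ => rfl, attractor_iterate T hn, ?_⟩
  rw [isNumberSystem_iff_iterate_eq_zero (fun a => (hdign a).1) hTn hstepn,
    isNumberSystem_iff_iterate_eq_zero (fun a => (hdig a).1) hT hstep]
  exact forall_iterate_iterate_eq_iff hn
end

section
/- Let (ℤ, b, 𝒟) be a pre-number system with attractor 𝒜, and let d = min 𝒟 and D = max 𝒟. Then for all a ∈ 𝒜: if b > 0, then −D ≤ a·(b − 1) ≤ −d; and if b < 0, then −d·b − D ≤ a·(b² − 1) ≤ −D·b − d. -/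
/-- A function that a self-map contracts by a factor `c > 1` is nonpositive at periodic points. -/
theorem nonpos_of_isPeriodicPt_of_mul_le {α : Type*} {F : α → α} {g : α → ℤ} {c : ℤ}
    (hc : 1 < c) (hg : ∀ x, c * g (F x) ≤ g x) {a : α} {n : ℕ} (hn : n ≠ 0)
    (ha : Function.IsPeriodicPt F n a) : g a ≤ 0 := by
  have hiter : ∀ k : ℕ, c ^ k * g (F^[k] a) ≤ g a := by
    intro k
    induction k with
    | zero => simp
    | succ k ih =>
      rw [Function.iterate_succ_apply', pow_succ, mul_assoc]
      exact (mul_le_mul_of_nonneg_left (hg _) (by positivity)).trans ih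
  have hle := hiter n
  rw [ha.eq] at hle
  have hpow : 1 < c ^ n := one_lt_pow₀ hc hn
  nlinarith

theorem attractor_bounds
    (b : ℤ) (D : Finset ℤ) (hb : 2 ≤ |b|)
    (hcard : D.card = b.natAbs)
    (hcover : ∀ a : ℤ, ∃ d ∈ D, b ∣ a - d)
    (dig : ℤ → ℤ) (hdig : ∀ a : ℤ, dig a ∈ D ∧ b ∣ a - dig a)
    (T : ℤ → ℤ) (hT : ∀ a : ℤ, b * T a = a - dig a)
    (dmin Dmax : ℤ) (hmin : IsLeast (↑D : Set ℤ) dmin)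
    (hmax : IsGreatest (↑D : Set ℤ) Dmax) :
    ∀ a ∈ attractor T,
      (0 < b → -Dmax ≤ a * (b - 1) ∧ a * (b - 1) ≤ -dmin) ∧
      (b < 0 → -dmin * b - Dmax ≤ a * (b ^ 2 - 1) ∧
        a * (b ^ 2 - 1) ≤ -Dmax * b - dmin) := by
  rintro a ⟨n, hn, ha⟩
  have hn0 : n ≠ 0 := by omega
  have hper : Function.IsPeriodicPt T n a := ha
  have hlo : ∀ x, dmin ≤ dig x := fun x => hmin.2 (hdig x).1
  have hhi : ∀ x, dig x ≤ Dmax := fun x => hmax.2 (hdig x).1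
  refine ⟨fun hpos => ?_, fun hneg => ?_⟩
  · rw [abs_of_pos hpos] at hb
    have hc : 1 < b := by omega
    constructor
    · have h := nonpos_of_isPeriodicPt_of_mul_le (g := fun x => -Dmax - x * (b - 1)) hc
        (fun x => by
          linear_combination (b - 1) * hhi x - (b - 1) * hT x) hn0 hper
      linarith
    · have h := nonpos_of_isPeriodicPt_of_mul_le (g := fun x => x * (b - 1) + dmin) hc
        (fun x => by
          linear_combination (b - 1) * hlo x + (b - 1) * hT x) hn0 hper
      linarith
  · rw [abs_of_neg hneg] at hb
    have hc : 1 < b ^ 2 := by nlinarith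
    have hc0 : 0 ≤ b ^ 2 - 1 := by linarith
    have hper2 : Function.IsPeriodicPt (T^[2]) n a := hper.iterate 2
    have hT2 : ∀ x, b ^ 2 * T (T x) = x - dig x - b * dig (T x) := fun x => by
      linear_combination b * hT (T x) + hT x
    constructor
    · have h := nonpos_of_isPeriodicPt_of_mul_le
        (g := fun x => -dmin * b - Dmax - x * (b ^ 2 - 1)) hc
        (fun x => by
          have hsum : dig x + b * dig (T x) ≤ Dmax + b * dmin :=
            add_le_add (hhi x) (mul_le_mul_of_nonpos_left (hlo _) hneg.le)
          change b ^ 2 * (-dmin * b - Dmax - T (T x) * (b ^ 2 - 1)) ≤ _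
          linear_combination (b ^ 2 - 1) * hsum - (b ^ 2 - 1) * hT2 x) hn0 hper2
      linarith
    · have h := nonpos_of_isPeriodicPt_of_mul_le
        (g := fun x => x * (b ^ 2 - 1) + Dmax * b + dmin) hc
        (fun x => by
          have hsum : dmin + b * Dmax ≤ dig x + b * dig (T x) :=
            add_le_add (hlo x) (mul_le_mul_of_nonpos_left (hhi _) hneg.le)
          change b ^ 2 * (T (T x) * (b ^ 2 - 1) + Dmax * b + dmin) ≤ _
          linear_combination (b ^ 2 - 1) * hsum + (b ^ 2 - 1) * hT2 x) hn0 hper2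
      linarith
end

section
/- Let (ℤ, b, 𝒟) be a pre-number system with 0 ∈ 𝒟. Then for each integer ℓ ≥ 1, the set of d ∈ bℤ such that the pre-number system (ℤ, b, (𝒟 \ {0}) ∪ {d}) has a zero expansion of length ℓ is finite. -/
/-- The only multiple of `b` in a complete residue system containing `0` is `0`. -/
theorem eq_zero_of_dvd_of_mem_residue_system
    {b : ℤ} {D : Finset ℤ} (hb : b ≠ 0) (hcard : D.card = b.natAbs)
    (hcover : ∀ a : ℤ, ∃ d ∈ D, b ∣ a - d) (h0 : (0 : ℤ) ∈ D)
    {x : ℤ} (hx : x ∈ D) (hbx : b ∣ x) : x = 0 := by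
  have : NeZero b.natAbs := ⟨Int.natAbs_ne_zero.mpr hb⟩
  have himage : D.image (Int.cast : ℤ → ZMod b.natAbs) = Finset.univ := by
    refine Finset.eq_univ_of_forall fun z => ?_
    obtain ⟨a, rfl⟩ := ZMod.intCast_surjective z
    obtain ⟨d, hd, hdvd⟩ := hcover a
    exact Finset.mem_image.mpr ⟨d, hd,
      (ZMod.intCast_eq_intCast_iff_dvd_sub d a _).mpr (Int.natAbs_dvd.mpr hdvd)⟩
  have hinj : Set.InjOn (Int.cast : ℤ → ZMod b.natAbs) D := by
    refine Finset.injOn_of_card_image_eq ?_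
    rw [himage, Finset.card_univ, ZMod.card, hcard]
  refine hinj hx h0 ?_
  rw [Int.cast_zero, ZMod.intCast_zmod_eq_zero_iff_dvd]
  exact Int.natAbs_dvd.mpr hbx

/-- If `d` is the lowest digit of a zero expansion whose other digits have absolute value at
most `M` unless they equal `d`, then `|d|` is bounded in terms of `M`, the base and the length. -/
theorem abs_zero_digit_le_of_sum_eq_zero
    {b d M : ℤ} (hb : 2 ≤ |b|) (hM : 0 ≤ M) {n : ℕ} {f : ℕ → ℤ} (hf0 : f 0 = d)
    (hf : ∀ i < n + 1, f i = d ∨ |f i| ≤ M)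
    (hsum : ∑ i ∈ Finset.range (n + 1), f i * b ^ i = 0) :
    |d| ≤ ∑ i ∈ Finset.range (n + 1), M * |b| ^ i := by
  set A : ℤ := ∑ i ∈ Finset.range (n + 1), if f i = d then b ^ i else 0 with hA
  set B : ℤ := ∑ i ∈ Finset.range (n + 1), if f i = d then 0 else f i * b ^ i with hB
  have hAB : d * A + B = 0 := by
    rw [← hsum, hA, hB, Finset.mul_sum, ← Finset.sum_add_distrib]
    refine Finset.sum_congr rfl fun i _ => ?_
    split_ifs with h <;> simp [h]
  have hA0 : A ≠ 0 := by
    intro hzero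
    have hdvd : b ∣ ∑ i ∈ Finset.range n, if f (i + 1) = d then b ^ (i + 1) else 0 := by
      refine Finset.dvd_sum fun i _ => ?_
      split_ifs
      · exact dvd_pow_self b i.succ_ne_zero
      · exact dvd_zero b
    rw [hA, Finset.sum_range_succ', if_pos hf0, pow_zero] at hzero
    have hone : b ∣ 1 := (dvd_add_right hdvd).mp (by rw [hzero]; exact dvd_zero b)
    have := Int.le_of_dvd one_pos ((abs_dvd b 1).mpr hone)
    omega
  calc |d| ≤ |d| * |A| := le_mul_of_one_le_right (abs_nonneg d) (Int.one_le_abs hA0)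
    _ = |B| := by rw [← abs_mul, eq_neg_of_add_eq_zero_left hAB, abs_neg]
    _ ≤ ∑ i ∈ Finset.range (n + 1), |if f i = d then 0 else f i * b ^ i| :=
      Finset.abs_sum_le_sum_abs _ _
    _ ≤ ∑ i ∈ Finset.range (n + 1), M * |b| ^ i := by
      refine Finset.sum_le_sum fun i hi => ?_
      split_ifs with h
      · rw [abs_zero]
        positivity
      · rw [abs_mul, abs_pow]
        have := (hf i (Finset.mem_range.mp hi)).resolve_left h
        gcongr

/-- For each length `ℓ ≥ 1`, only finitely many replacements `d ∈ bℤ` of the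
digit `0` yield a pre-number system having a zero expansion of length `ℓ`. -/
theorem finitely_many_zero_digits_with_zero_expansion_of_length
    (b : ℤ) (D : Finset ℤ) (hb : 2 ≤ |b|)
    (hcard : D.card = b.natAbs)
    (hcover : ∀ a : ℤ, ∃ d ∈ D, b ∣ a - d)
    (h0 : (0 : ℤ) ∈ D)
    (ℓ : ℕ) (hℓ : 1 ≤ ℓ) :
    {d : ℤ | b ∣ d ∧ ∃ f : ℕ → ℤ, (∀ i < ℓ, f i ∈ insert d (D.erase 0)) ∧
      ∑ i ∈ Finset.range ℓ, f i * b ^ i = 0}.Finite := by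
  obtain ⟨n, rfl⟩ := Nat.exists_eq_add_of_le' hℓ
  have hb0 : b ≠ 0 := by
    rintro rfl
    simp at hb
  set M : ℤ := ∑ x ∈ D, |x|
  set C : ℤ := ∑ i ∈ Finset.range (n + 1), M * |b| ^ i
  refine (Set.finite_Icc (-C) C).subset ?_
  rintro d ⟨-, f, hf, hsum⟩
  have hf0 : f 0 = d := by
    rcases Finset.mem_insert.mp (hf 0 n.succ_pos) with h | h
    · exact h
    · obtain ⟨hne, hmem⟩ := Finset.mem_erase.mp h
      refine absurd (eq_zero_of_dvd_of_mem_residue_system hb0 hcard hcover h0 hmem ?_) hne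
      rw [Finset.sum_range_succ', pow_zero, mul_one] at hsum
      refine (dvd_add_right (Finset.dvd_sum fun i _ => ?_)).mp (by rw [hsum]; exact dvd_zero b)
      exact (dvd_pow_self b i.succ_ne_zero).mul_left _
  refine abs_le.mp (abs_zero_digit_le_of_sum_eq_zero hb
    (Finset.sum_nonneg fun x _ => abs_nonneg x) hf0 (fun i hi => ?_) hsum)
  refine (Finset.mem_insert.mp (hf i hi)).imp_right fun h => ?_
  exact Finset.single_le_sum (f := fun x : ℤ => |x|) (fun x _ => abs_nonneg x)
    (Finset.mem_of_mem_erase h)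
end

section
/- Let b ∈ ℤ with |b| ≥ 3, and let 𝒟 ⊆ ℤ be a complete residue system modulo b such that: (i) |d| ≤ |b| for all d ∈ 𝒟; (ii) 1 ∈ 𝒟 or −1 ∈ 𝒟; (iii) b − 1 ∉ 𝒟 and −b + 1 ∉ 𝒟. Then (ℤ, b, 𝒟) is a number system. -/
def HasExpansion (b : ℤ) (D : Finset ℤ) (a : ℤ) : Prop :=
  ∃ ℓ : ℕ, ∃ f : ℕ → ℤ, IsExpansion b D a ℓ f

theorem hasExpansion_of_mem {b : ℤ} {D : Finset ℤ} {d : ℤ} (hd : d ∈ D) :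
    HasExpansion b D d :=
  ⟨1, fun _ => d, le_rfl, fun _ _ => hd, by simp⟩

theorem HasExpansion.digit_add_mul {b : ℤ} {D : Finset ℤ} {d a : ℤ}
    (ha : HasExpansion b D a) (hd : d ∈ D) : HasExpansion b D (d + b * a) := by
  obtain ⟨ℓ, f, -, hf, rfl⟩ := ha
  refine ⟨ℓ + 1, fun i => Nat.casesOn i d f, by omega, ?_, ?_⟩
  · rintro (_ | i) hi
    · exact hd
    · exact hf i (by omega)
  · rw [Finset.sum_range_succ', Finset.mul_sum, add_comm]
    simp only [pow_zero, mul_one]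
    congr 1
    exact Finset.sum_congr rfl fun i _ => by rw [pow_succ]; ring

theorem exists_digit_add_mul {b : ℤ} {D : Finset ℤ}
    (hcover : ∀ a : ℤ, ∃ d ∈ D, b ∣ a - d) (hsize : ∀ d ∈ D, |d| ≤ |b|) (a : ℤ) :
    ∃ d ∈ D, ∃ k : ℤ, a = d + b * k ∧ |b| * |k| ≤ |a| + |b| := by
  obtain ⟨d, hd, k, hk⟩ := hcover a
  refine ⟨d, hd, k, by linarith, ?_⟩
  rw [← abs_mul, ← hk]
  exact (abs_sub a d).trans (by linarith [hsize d hd])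

theorem hasExpansion_of_forall_abs_le_one {b : ℤ} {D : Finset ℤ} (hb : 3 ≤ |b|)
    (hcover : ∀ a : ℤ, ∃ d ∈ D, b ∣ a - d) (hsize : ∀ d ∈ D, |d| ≤ |b|)
    (hsmall : ∀ a : ℤ, |a| ≤ 1 → HasExpansion b D a) (a : ℤ) : HasExpansion b D a := by
  induction h : a.natAbs using Nat.strong_induction_on generalizing a with
  | _ n ih =>
    by_cases ha : |a| ≤ 1
    · exact hsmall a ha
    obtain ⟨d, hd, k, hk, hle⟩ := exists_digit_add_mul hcover hsize a
    have hlt : |k| < |a| := by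
      by_contra! hge
      nlinarith
    rw [hk]
    exact (ih k.natAbs (by zify [← h]; exact hlt) k rfl).digit_add_mul hd

theorem small_digit_sets_are_number_systems
    (b : ℤ) (D : Finset ℤ) (hb : 3 ≤ |b|)
    (hcard : D.card = b.natAbs)
    (hcover : ∀ a : ℤ, ∃ d ∈ D, b ∣ a - d)
    (hsize : ∀ d ∈ D, |d| ≤ |b|)
    (hone : (1 : ℤ) ∈ D ∨ (-1 : ℤ) ∈ D)
    (hnot : (b - 1) ∉ D ∧ (-b + 1) ∉ D) :
    IsNumberSystem b D := by
  have step : ∀ a : ℤ, |a| ≤ 1 → ∃ d ∈ D, ∃ k : ℤ, a = d + b * k ∧ (k = -1 ∨ k = 0 ∨ k = 1) := by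
    intro a ha
    obtain ⟨d, hd, k, hk, hle⟩ := exists_digit_add_mul hcover hsize a
    have hk1 : |k| < 2 := by
      by_contra! hge
      nlinarith
    exact ⟨d, hd, k, hk, by grind⟩
  have hpm : HasExpansion b D 1 ∧ HasExpansion b D (-1) := by
    rcases hone with h1 | h1
    · have hexp : HasExpansion b D 1 := hasExpansion_of_mem h1
      refine ⟨hexp, ?_⟩
      obtain ⟨d, hd, k, hk, rfl | rfl | rfl⟩ := step (-1) (by norm_num)
      · exact absurd (by rwa [show b - 1 = d by linarith]) hnot.1
      · exact hasExpansion_of_mem (by rwa [show -1 = d by linarith])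
      · exact hk ▸ hexp.digit_add_mul hd
    · have hexp : HasExpansion b D (-1) := hasExpansion_of_mem h1
      refine ⟨?_, hexp⟩
      obtain ⟨d, hd, k, hk, rfl | rfl | rfl⟩ := step 1 (by norm_num)
      · exact hk ▸ hexp.digit_add_mul hd
      · exact hasExpansion_of_mem (by rwa [show 1 = d by linarith])
      · exact absurd (by rwa [show -b + 1 = d by linarith]) hnot.2
  have hzero : HasExpansion b D 0 := by
    obtain ⟨d, hd, k, hk, rfl | rfl | rfl⟩ := step 0 (by norm_num)
    · exact hk ▸ hpm.2.digit_add_mul hd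
    · exact hasExpansion_of_mem (by rwa [show 0 = d by linarith])
    · exact hk ▸ hpm.1.digit_add_mul hd
  refine hasExpansion_of_forall_abs_le_one hb hcover hsize fun a ha => ?_
  obtain rfl | rfl | rfl : a = -1 ∨ a = 0 ∨ a = 1 := by grind
  · exact hpm.2
  · exact hzero
  · exact hpm.1
end

section
/- Let b ∈ ℤ be odd with |b| ≥ 3, and let 𝒟_{b,odd} be the set of odd digits modulo b: if b > 0, 𝒟_{b,odd} = {x ∈ ℤ : x odd, −b + 2 ≤ x ≤ b}; if b < 0, 𝒟_{b,odd} = {x ∈ ℤ : x odd, b ≤ x ≤ −b − 2}. Then (ℤ, b, 𝒟_{b,odd}) is a number system. -/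
theorem IsExpansion.singleton (b : ℤ) {D : Finset ℤ} {d : ℤ} (hd : d ∈ D) :
    IsExpansion b D d 1 fun _ => d :=
  ⟨le_rfl, fun _ _ => hd, by simp⟩

theorem IsExpansion.cons {b : ℤ} {D : Finset ℤ} {a d : ℤ} {ℓ : ℕ} {f : ℕ → ℤ}
    (h : IsExpansion b D a ℓ f) (hd : d ∈ D) :
    IsExpansion b D (d + b * a) (ℓ + 1) fun i => Nat.casesOn i d f := by
  obtain ⟨-, hf, rfl⟩ := h
  refine ⟨by omega, ?_, ?_⟩
  · rintro (_ | i) hi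
    · exact hd
    · exact hf i (by omega)
  · rw [Finset.sum_range_succ', Finset.mul_sum, add_comm]
    congr 1
    · exact Finset.sum_congr rfl fun i _ => by ring
    · simp

/-- A digit set bounded by `|b|` that contains a digit for every residue class, as well as `1`,
`-1` and `b`, gives a number system. -/
theorem isNumberSystem_of_abs_le {b : ℤ} (hb : 3 ≤ |b|) {D : Finset ℤ}
    (hres : ∀ a : ℤ, ∃ d ∈ D, b ∣ a - d) (hD : ∀ d ∈ D, |d| ≤ |b|)
    (hone : 1 ∈ D) (hneg : -1 ∈ D) (hbase : b ∈ D) : IsNumberSystem b D := by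
  intro a
  induction hn : a.natAbs using Nat.strong_induction_on generalizing a with
  | _ n ih =>
    rcases lt_or_ge n 2 with h | h
    · have ha : a = 0 ∨ a = 1 ∨ a = -1 := by omega
      rcases ha with rfl | rfl | rfl
      · have hexp := (IsExpansion.singleton b hneg).cons hbase
        rw [mul_neg_one, add_neg_cancel] at hexp
        exact ⟨_, _, hexp⟩
      · exact ⟨_, _, .singleton b hone⟩
      · exact ⟨_, _, .singleton b hneg⟩
    · obtain ⟨d, hd, q, hq⟩ := hres a
      have hle : |b| * |q| ≤ |a| + |b| := by
        rw [← abs_mul, ← hq]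
        exact (abs_sub a d).trans (add_le_add_right (hD d hd) _)
      have ha : 2 ≤ |a| := by rw [Int.abs_eq_natAbs]; omega
      have hlt : |q| < |a| := by nlinarith
      rw [Int.abs_eq_natAbs, Int.abs_eq_natAbs] at hlt
      obtain ⟨ℓ, f, hf⟩ := ih q.natAbs (by omega) q rfl
      have hexp := hf.cons hd
      rw [← hq, add_sub_cancel] at hexp
      exact ⟨_, _, hexp⟩

section OddWindow

variable {m : ℤ} {n : ℕ} {D : Finset ℤ}

theorem card_odd_window (hm : Odd m) (hD : ∀ x, x ∈ D ↔ Odd x ∧ m ≤ x ∧ x < m + 2 * n) :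
    D.card = n := by
  have himage : D = (Finset.range n).image fun i : ℕ => m + 2 * (i : ℤ) := by
    ext x
    simp only [hD, Finset.mem_image, Finset.mem_range]
    obtain ⟨k, rfl⟩ := hm
    constructor
    · rintro ⟨⟨j, rfl⟩, h⟩
      exact ⟨(j - k).toNat, by omega, by omega⟩
    · rintro ⟨i, hi, rfl⟩
      exact ⟨⟨k + i, by ring⟩, by omega, by omega⟩
  rw [himage, Finset.card_image_of_injective _ fun i j hij => by simpa using hij,
    Finset.card_range]

theorem exists_mem_odd_window_dvd_sub (hn : Odd n)
    (hD : ∀ x, x ∈ D ↔ Odd x ∧ m ≤ x ∧ x < m + 2 * n) (a : ℤ) :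
    ∃ d ∈ D, (n : ℤ) ∣ a - d := by
  have hpos : (0 : ℤ) < 2 * n := by have := hn.pos; omega
  have hodd_case : ∀ c : ℤ, Odd c → ∃ d ∈ D, (n : ℤ) ∣ c - d := by
    intro c hc
    have hdiv := Int.emod_add_mul_ediv (c - m) (2 * n)
    have hlt := Int.emod_lt_of_pos (c - m) hpos
    have hnonneg := Int.emod_nonneg (c - m) hpos.ne'
    refine ⟨m + (c - m) % (2 * n), (hD _).2 ⟨?_, by omega, by omega⟩,
      2 * ((c - m) / (2 * n)), by linear_combination -hdiv⟩
    have heq : m + (c - m) % (2 * n) = c - 2 * (n * ((c - m) / (2 * n))) := by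
      linear_combination hdiv
    rw [heq]
    exact hc.sub_even (even_two_mul _)
  rcases Int.even_or_odd a with ha | ha
  · obtain ⟨d, hd, hdvd⟩ := hodd_case (a + n) (ha.add_odd (by exact_mod_cast hn))
    refine ⟨d, hd, ?_⟩
    rwa [add_sub_right_comm, dvd_add_self_right] at hdvd
  · exact hodd_case a ha

end OddWindow

/-- The odd digit set modulo an odd base `b` with `|b| ≥ 3` is a complete
residue system modulo `b` and yields a number system. -/
theorem odd_digit_set_number_system
    (b : ℤ) (hb : 3 ≤ |b|) (hodd : Odd b)
    (Dodd : Finset ℤ)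
    (hDodd : ∀ x : ℤ, x ∈ Dodd ↔ Odd x ∧
      (0 < b → -b + 2 ≤ x ∧ x ≤ b) ∧ (b < 0 → b ≤ x ∧ x ≤ -b - 2)) :
    Dodd.card = b.natAbs ∧
    (∀ a : ℤ, ∃ d ∈ Dodd, b ∣ a - d) ∧
    IsNumberSystem b Dodd := by
  obtain ⟨m, hm, hD⟩ : ∃ m : ℤ, Odd m ∧
      ∀ x, x ∈ Dodd ↔ Odd x ∧ m ≤ x ∧ x < m + 2 * (b.natAbs : ℤ) := by
    rcases lt_or_ge 0 b with h | h
    · refine ⟨-b + 2, hodd.neg.add_even even_two, fun x => ?_⟩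
      rw [hDodd]
      obtain ⟨k, rfl⟩ := hodd
      refine and_congr_right ?_
      rintro ⟨j, rfl⟩
      omega
    · refine ⟨b, hodd, fun x => ?_⟩
      rw [hDodd]
      obtain ⟨k, rfl⟩ := hodd
      refine and_congr_right ?_
      rintro ⟨j, rfl⟩
      omega
  have hres : ∀ a : ℤ, ∃ d ∈ Dodd, b ∣ a - d := fun a => by
    simpa only [Int.natAbs_dvd] using
      exists_mem_odd_window_dvd_sub (Int.natAbs_odd.2 hodd) hD a
  have hb' := hb
  rw [Int.abs_eq_natAbs] at hb'
  refine ⟨card_odd_window hm hD, hres, isNumberSystem_of_abs_le hb hres ?_ ?_ ?_ ?_⟩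
  · intro d hd
    have hmem := (hDodd d).1 hd
    rw [abs_le, Int.abs_eq_natAbs]
    omega
  · exact (hDodd _).2 ⟨odd_one, by omega, by omega⟩
  · exact (hDodd _).2 ⟨odd_neg_one, by omega, by omega⟩
  · exact (hDodd _).2 ⟨hodd, by omega, by omega⟩
end

section
/- Let (ℤ, b, 𝒟) be a pre-number system with dynamic mapping T and attractor 𝒜. If (ℤ, b, 𝒟) is a number system, then 𝒜 contains at least one element of 𝒟, i.e., there exists d ∈ 𝒟 and n ≥ 1 with T^n(d) = d. -/
/-- Iterating the dynamic mapping on a number with a finite expansion reaches its leading digit. -/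
theorem iterate_mem_of_isExpansion {b : ℤ} {D : Finset ℤ} (hb : b ≠ 0)
    (hcard : D.card = b.natAbs) (hcover : ∀ a : ℤ, ∃ d ∈ D, b ∣ a - d)
    {dig : ℤ → ℤ} (hdig : ∀ a : ℤ, dig a ∈ D ∧ b ∣ a - dig a)
    {T : ℤ → ℤ} (hT : ∀ a : ℤ, b * T a = a - dig a) (k : ℕ) (a : ℤ) (f : ℕ → ℤ)
    (h : IsExpansion b D a (k + 1) f) : T^[k] a ∈ D := by
  induction k generalizing a f with
  | zero =>
    obtain ⟨-, hf, ha⟩ := h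
    simpa [ha] using hf 0 (by omega)
  | succ k ih =>
    obtain ⟨-, hf, ha⟩ := h
    rw [Finset.sum_range_succ', pow_zero, mul_one] at ha
    have hsum : ∑ i ∈ Finset.range (k + 1), f (i + 1) * b ^ (i + 1) =
        b * ∑ i ∈ Finset.range (k + 1), f (i + 1) * b ^ i := by
      rw [Finset.mul_sum]
      exact Finset.sum_congr rfl fun i _ => by ring
    rw [hsum] at ha
    have hda : f 0 = dig a := by
      refine digit_eq_of_dvd_sub hb hcard hcover (hf 0 (by omega)) (hdig a).1 ?_
      have h0 : b ∣ a - f 0 := ⟨_, sub_eq_of_eq_add ha⟩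
      simpa using dvd_sub (hdig a).2 h0
    rw [Function.iterate_succ_apply]
    refine ih (T a) (fun i => f (i + 1)) ⟨by omega, fun i hi => hf _ (by omega), ?_⟩
    exact mul_left_cancel₀ hb (by rw [hT, ← hda]; linarith)


theorem attractor_contains_digit
    (b : ℤ) (D : Finset ℤ) (hb : 2 ≤ |b|)
    (hcard : D.card = b.natAbs)
    (hcover : ∀ a : ℤ, ∃ d ∈ D, b ∣ a - d)
    (dig : ℤ → ℤ) (hdig : ∀ a : ℤ, dig a ∈ D ∧ b ∣ a - dig a)
    (T : ℤ → ℤ) (hT : ∀ a : ℤ, b * T a = a - dig a)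
    (hns : IsNumberSystem b D) :
    ∃ d ∈ D, ∃ n : ℕ, 1 ≤ n ∧ T^[n] d = d := by
  have hb0 : b ≠ 0 := by
    rintro rfl
    norm_num at hb
  obtain ⟨ℓ, f, h⟩ := hns 0
  obtain ⟨k, rfl⟩ := Nat.exists_eq_add_of_le' h.1
  have hmem := iterate_mem_of_isExpansion hb0 hcard hcover hdig hT k 0 f h
  refine ⟨_, hmem, k + 1, by omega, ?_⟩
  have hd := digit_eq_of_dvd_sub hb0 hcard hcover hmem (hdig _).1 (hdig _).2
  have hT0 : T (T^[k] 0) = 0 := by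
    have h1 := hT (T^[k] 0)
    rw [← hd, sub_self] at h1
    exact (mul_eq_zero.mp h1).resolve_left hb0
  rw [Function.iterate_succ_apply, hT0]
end

section
/- Let (ℤ, b, 𝒟) be a number system and set K = max_{d ∈ 𝒟} |d|. If K ≥ |b| − 1, then there exists a nonzero digit d ∈ 𝒟 with |d|·(|b| − 1) ≤ K. -/
/-- The interval `|x| ≤ K / (|b| - 1)` is stable under removing the last digit. -/
theorem abs_mul_le_of_eq_digit_add_mul {b a a' d K : ℤ} (hb : 2 ≤ |b|) (hd : |d| ≤ K)
    (ha : |a| * (|b| - 1) ≤ K) (h : a = d + b * a') : |a'| * (|b| - 1) ≤ K := by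
  have hle : |b| * |a'| ≤ |a| + K := by
    rw [← abs_mul, show b * a' = a - d by rw [h]; ring]
    exact (abs_sub a d).trans (by gcongr)
  refine le_of_mul_le_mul_left ?_ (show 0 < |b| by linarith)
  calc |b| * (|a'| * (|b| - 1)) = |b| * |a'| * (|b| - 1) := by ring
    _ ≤ (|a| + K) * (|b| - 1) := mul_le_mul_of_nonneg_right hle (by linarith)
    _ ≤ |b| * K := by linarith

/-- If a nonzero integer of absolute value at most `K / (|b| - 1)` has a digit expansion, then
some nonzero digit satisfies the same bound. -/
theorem exists_nonzero_digit_of_expansion {b K : ℤ} {D : Finset ℤ} (hb : 2 ≤ |b|)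
    (hK : ∀ d ∈ D, |d| ≤ K) (ℓ : ℕ) :
    ∀ (a : ℤ) (f : ℕ → ℤ), a ≠ 0 → |a| * (|b| - 1) ≤ K → (∀ i < ℓ, f i ∈ D) →
      a = ∑ i ∈ Finset.range ℓ, f i * b ^ i → ∃ d ∈ D, d ≠ 0 ∧ |d| * (|b| - 1) ≤ K := by
  induction ℓ with
  | zero => intro a f ha _ _ hsum; simp at hsum; contradiction
  | succ n ih =>
    intro a f ha hle hf hsum
    set a' := ∑ i ∈ Finset.range n, f (i + 1) * b ^ i with ha'
    have hstep : a = f 0 + b * a' := by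
      rw [hsum, Finset.sum_range_succ', ha', Finset.mul_sum, pow_zero, mul_one, add_comm]
      congr 1
      exact Finset.sum_congr rfl fun i _ => by ring
    have hf0 : f 0 ∈ D := hf 0 n.succ_pos
    by_cases h0 : a' = 0
    · have hfa : a = f 0 := by rw [hstep, h0, mul_zero, add_zero]
      exact ⟨a, hfa ▸ hf0, ha, hle⟩
    · exact ih a' (fun i => f (i + 1)) h0
        (abs_mul_le_of_eq_digit_add_mul hb (hK _ hf0) hle hstep)
        (fun i hi => hf (i + 1) (Nat.succ_lt_succ hi)) ha'

/-- In a number system whose largest digit (in absolute value) `K` satisfies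
`K ≥ |b| - 1`, there is a nonzero digit `d` with `|d| ≤ K/(|b|-1)`. -/
theorem exists_small_nonzero_digit
    (b : ℤ) (D : Finset ℤ) (hb : 2 ≤ |b|)
    (hcard : D.card = b.natAbs)
    (hcover : ∀ a : ℤ, ∃ d ∈ D, b ∣ a - d)
    (hns : IsNumberSystem b D)
    (K : ℤ) (hK₁ : ∀ d ∈ D, |d| ≤ K) (hK₂ : ∃ d ∈ D, |d| = K)
    (hKlarge : |b| - 1 ≤ K) :
    ∃ d ∈ D, d ≠ 0 ∧ |d| * (|b| - 1) ≤ K := by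
  obtain ⟨ℓ, f, -, hf, hsum⟩ := hns 1
  exact exists_nonzero_digit_of_expansion hb hK₁ ℓ 1 f one_ne_zero (by simpa using hKlarge) hf hsum
end

section
/- Let (ℤ, b, 𝒟) be a pre-number system with |b| ≥ 3, and for t ∈ ℤ set 𝒟_t = {d + t : d ∈ 𝒟}. Then the set of t ∈ ℤ such that (ℤ, b, 𝒟_t) is a number system is finite. Moreover, if 0 ∈ 𝒟 and 𝒟̃_t = {d + t : d ∈ 𝒟, d ≠ 0} ∪ {0}, then the set of t ∈ ℤ such that (ℤ, b, 𝒟̃_t) is a pre-number system that is a number system is finite. -/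
theorem two_mul_abs_sum_mul_pow_le {b U : ℤ} (hb : 3 ≤ |b|) (hU : 0 ≤ U) (f : ℕ → ℤ) (n : ℕ)
    (hf : ∀ i < n, |f i| ≤ U) :
    2 * |∑ i ∈ Finset.range n, f i * b ^ i| ≤ U * (|b| ^ n - 1) := by
  induction n with
  | zero => simp
  | succ n ih =>
    have ih' := ih fun i hi => hf i (by omega)
    have hlead : |f n * b ^ n| ≤ U * |b| ^ n := by
      rw [abs_mul, abs_pow]
      exact mul_le_mul_of_nonneg_right (hf n (by omega)) (by positivity)
    have htri := abs_add_le (∑ i ∈ Finset.range n, f i * b ^ i) (f n * b ^ n)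
    have hpow : U * |b| ^ n * 3 ≤ U * |b| ^ n * |b| :=
      mul_le_mul_of_nonneg_left hb (by positivity)
    rw [Finset.sum_range_succ, pow_succ]
    linarith

/-- If the nonzero digits have comparable absolute values, an expansion with a nonzero digit
has a value bounded away from zero. -/
theorem forall_eq_zero_or_le_two_mul_abs_sum {b L U : ℤ} (hb : 3 ≤ |b|) (hU : 0 ≤ U)
    (hLU : U ≤ 2 * L) (f : ℕ → ℤ) (n : ℕ)
    (hf : ∀ i < n, f i = 0 ∨ (L ≤ |f i| ∧ |f i| ≤ U)) :
    (∀ i < n, f i = 0) ∨ U ≤ 2 * |∑ i ∈ Finset.range n, f i * b ^ i| := by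
  induction n with
  | zero => simp
  | succ n ih =>
    rw [Finset.sum_range_succ]
    rcases hf n (by omega) with h0 | ⟨hL, -⟩
    · rcases ih fun i hi => hf i (by omega) with h | h
      · left
        intro i hi
        rcases Nat.lt_succ_iff_lt_or_eq.mp hi with hi | rfl
        exacts [h i hi, h0]
      · right
        simpa [h0] using h
    · right
      have htail := two_mul_abs_sum_mul_pow_le hb hU f n fun i hi => by
        rcases hf i (by omega) with h | h
        · simpa [h] using hU
        · exact h.2
      have hlead : L * |b| ^ n ≤ |f n * b ^ n| := by
        rw [abs_mul, abs_pow]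
        exact mul_le_mul_of_nonneg_right hL (by positivity)
      have htri := abs_sub_abs_le_abs_add (f n * b ^ n) (∑ i ∈ Finset.range n, f i * b ^ i)
      rw [add_comm] at htri
      have hpow : U * |b| ^ n ≤ 2 * L * |b| ^ n :=
        mul_le_mul_of_nonneg_right hLU (by positivity)
      linarith

theorem abs_translate_bounds {C d : ℤ} (t : ℤ) (hd : |d| ≤ C) :
    |t| - C ≤ |d + t| ∧ |d + t| ≤ |t| + C := by
  have h₁ := abs_add_le d t
  have h₂ := abs_sub_abs_le_abs_add t d
  rw [add_comm] at h₂
  constructor <;> linarith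

/-- Only finitely many translates of a digit set give number systems; likewise
for translating all nonzero digits while keeping `0` in place. -/
theorem finitely_many_translates
    (b : ℤ) (D : Finset ℤ) (hb : 3 ≤ |b|)
    (hcard : D.card = b.natAbs)
    (hcover : ∀ a : ℤ, ∃ d ∈ D, b ∣ a - d) :
    {t : ℤ | IsNumberSystem b (D.image (fun d => d + t))}.Finite ∧
    ((0 : ℤ) ∈ D →
      {t : ℤ |
        (insert (0 : ℤ) ((D.erase 0).image (fun d => d + t))).card = b.natAbs ∧
        (∀ a : ℤ, ∃ d ∈ insert (0 : ℤ) ((D.erase 0).image (fun d => d + t)),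
          b ∣ a - d) ∧
        IsNumberSystem b (insert (0 : ℤ) ((D.erase 0).image (fun d => d + t)))
        }.Finite) := by
  obtain ⟨C, hC⟩ : ∃ C : ℤ, ∀ d ∈ D, |d| ≤ C :=
    ⟨∑ d ∈ D, |d|, fun d hd => Finset.single_le_sum (f := fun d => |d|)
      (fun _ _ => abs_nonneg _) hd⟩
  have hC0 : 0 ≤ C := by
    obtain ⟨d, hd, -⟩ := hcover 0
    exact (abs_nonneg d).trans (hC d hd)
  refine ⟨(Set.finite_Icc (-(3 * C + 3)) (3 * C + 3)).subset ?_,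
    fun _ => (Set.finite_Icc (-(3 * C + 3)) (3 * C + 3)).subset ?_⟩
  · intro t ht
    rw [Set.mem_Icc, ← abs_le]
    by_contra! hlt
    obtain ⟨n, f, hn, hf, hsum⟩ := ht 0
    have hdigit : ∀ i < n, |t| - C ≤ |f i| ∧ |f i| ≤ |t| + C := by
      intro i hi
      obtain ⟨d, hd, hdi⟩ := Finset.mem_image.mp (hf i hi)
      rw [← hdi]
      exact abs_translate_bounds t (hC d hd)
    rcases forall_eq_zero_or_le_two_mul_abs_sum hb (by linarith) (by linarith) f n
      fun i hi => Or.inr (hdigit i hi) with h | h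
    · have := (hdigit 0 hn).1
      rw [h 0 hn, abs_zero] at this
      linarith
    · rw [← hsum, abs_zero] at h
      linarith
  · rintro t ⟨-, -, ht⟩
    rw [Set.mem_Icc, ← abs_le]
    by_contra! hlt
    obtain ⟨n, f, -, hf, hsum⟩ := ht 1
    have hdigit : ∀ i < n, f i = 0 ∨ (|t| - C ≤ |f i| ∧ |f i| ≤ |t| + C) := by
      intro i hi
      refine (Finset.mem_insert.mp (hf i hi)).imp_right fun h => ?_
      obtain ⟨d, hd, hdi⟩ := Finset.mem_image.mp h
      rw [← hdi]
      exact abs_translate_bounds t (hC d (Finset.mem_of_mem_erase hd))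
    rcases forall_eq_zero_or_le_two_mul_abs_sum hb (by linarith) (by linarith) f n hdigit
      with h | h
    · rw [Finset.sum_eq_zero fun i hi => by simp [h i (Finset.mem_range.mp hi)]] at hsum
      exact one_ne_zero hsum
    · rw [← hsum, abs_one] at h
      linarith
end

section
/- Let (ℤ, b, 𝒟) be a number system with b ≥ 3 and |d'| ≤ b for all d' ∈ 𝒟. Fix d ∈ 𝒟 and an integer u ≠ 0 with |u| ≤ b − 1; if 0 ∉ 𝒟, assume |u| ≤ b − 2. Let ℬ be the set of digits of 𝒟 that occur as a component of a minimal-length expansion of 0, of u + 1, of u, or of u − 1. If d ∉ ℬ, then for every integer k ≥ 1 the pre-number system (ℤ, b, (𝒟 \ {d}) ∪ {d − u·b^k}) is a number system. -/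
/-- An expansion of `a` of minimal length among all expansions of `a`. -/
def IsMinimalExpansion (b : ℤ) (D : Finset ℤ) (a : ℤ) (ℓ : ℕ) (f : ℕ → ℤ) : Prop :=
  IsExpansion b D a ℓ f ∧ ∀ ℓ' : ℕ, ∀ f' : ℕ → ℤ, IsExpansion b D a ℓ' f' → ℓ ≤ ℓ'

/-- The set of "bad" digits: those occurring in a minimal-length expansion of
`0`, `u + 1`, `u`, or `u - 1`. -/
def badSet (b : ℤ) (D : Finset ℤ) (u : ℤ) : Set ℤ :=
  {x : ℤ | ∃ a ∈ ({0, u + 1, u, u - 1} : Set ℤ), ∃ ℓ : ℕ, ∃ f : ℕ → ℤ,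
    IsMinimalExpansion b D a ℓ f ∧ ∃ i < ℓ, f i = x}

/-- `a` has an expansion in base `b` with digits in `D`. -/
def Expandable (b : ℤ) (D : Finset ℤ) (a : ℤ) : Prop :=
  ∃ ℓ : ℕ, ∃ f : ℕ → ℤ, IsExpansion b D a ℓ f

/-- The value in base `b` of a word of binary digits, least significant digit first. -/
def binaryValue (b : ℤ) : List Bool → ℤ
  | [] => 0
  | s :: t => s.toInt + b * binaryValue b t

theorem binaryValue_replicate_false (b : ℤ) (n : ℕ) :
    binaryValue b (List.replicate n false) = 0 := by
  induction n with
  | zero => rfl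
  | succ n ih => simp [List.replicate_succ, binaryValue, ih]

theorem binaryValue_append_singleton (b : ℤ) (t : List Bool) (s : Bool) :
    binaryValue b (t ++ [s]) = binaryValue b t + s.toInt * b ^ t.length := by
  induction t with
  | nil => simp [binaryValue]
  | cons r t ih =>
    simp only [List.cons_append, binaryValue, ih, List.length_cons]
    ring

theorem sum_range_succ_mul_pow (b : ℤ) (f : ℕ → ℤ) (ℓ : ℕ) :
    ∑ i ∈ Finset.range (ℓ + 1), f i * b ^ i
      = f 0 + b * ∑ i ∈ Finset.range ℓ, f (i + 1) * b ^ i := by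
  rw [Finset.sum_range_succ', Finset.mul_sum, add_comm]
  congr 1
  · simp
  · exact Finset.sum_congr rfl fun i _ => by ring

theorem Expandable.cons {b : ℤ} {D : Finset ℤ} {e x : ℤ} (he : e ∈ D)
    (hx : Expandable b D x) : Expandable b D (e + b * x) := by
  obtain ⟨ℓ, f, -, hf, rfl⟩ := hx
  refine ⟨ℓ + 1, fun i => Nat.casesOn i e f, by omega, ?_, ?_⟩
  · rintro (_ | i) hi
    · exact he
    · exact hf i (by omega)
  · exact (sum_range_succ_mul_pow b (fun i => Nat.casesOn i e f) ℓ).symm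

theorem Expandable.exists_digit {b : ℤ} {D : Finset ℤ} {x : ℤ} (hx : Expandable b D x) :
    ∃ e ∈ D, ∃ y, x = e + b * y ∧ (y = 0 ∨ Expandable b D y) := by
  obtain ⟨ℓ, f, hℓ, hf, rfl⟩ := hx
  obtain ⟨ℓ, rfl⟩ : ∃ m, ℓ = m + 1 := ⟨ℓ - 1, by omega⟩
  refine ⟨f 0, hf 0 (by omega), _, sum_range_succ_mul_pow b f ℓ, ?_⟩
  rcases Nat.eq_zero_or_pos ℓ with rfl | hpos
  · simp
  · exact Or.inr ⟨ℓ, fun i => f (i + 1), hpos, fun i hi => hf _ (by omega), rfl⟩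

theorem Expandable.mono {b : ℤ} {D D' : Finset ℤ} {x : ℤ} (h : D ⊆ D')
    (hx : Expandable b D x) : Expandable b D' x := by
  obtain ⟨ℓ, f, hℓ, hf, e⟩ := hx
  exact ⟨ℓ, f, hℓ, fun i hi => h (hf i hi), e⟩

theorem Expandable.exists_isMinimalExpansion {b : ℤ} {D : Finset ℤ} {x : ℤ}
    (hx : Expandable b D x) : ∃ ℓ f, IsMinimalExpansion b D x ℓ f := by
  classical
  obtain ⟨f, hf⟩ := Nat.find_spec hx
  exact ⟨Nat.find hx, f, hf, fun ℓ' f' h' => Nat.find_min' hx ⟨f', h'⟩⟩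

/-- Avoiding the bad set, the numbers `0`, `u + 1`, `u`, `u - 1` are expandable without `d`. -/
theorem expandable_erase_of_notMem_badSet {b : ℤ} {D : Finset ℤ} {d u a : ℤ}
    (hns : IsNumberSystem b D) (hbad : d ∉ badSet b D u)
    (ha : a ∈ ({0, u + 1, u, u - 1} : Set ℤ)) : Expandable b (D.erase d) a := by
  obtain ⟨ℓ, f, hf⟩ := Expandable.exists_isMinimalExpansion (hns a)
  exact ⟨ℓ, f, hf.1.1, fun i hi => Finset.mem_erase.2
    ⟨fun h => hbad ⟨a, ha, ℓ, f, hf, i, hi, h⟩, hf.1.2.1 i hi⟩, hf.1.2.2⟩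

theorem eq_of_dvd_sub_of_cover {b : ℤ} {D : Finset ℤ} (hb : b ≠ 0)
    (hcard : D.card = b.natAbs) (hcover : ∀ a : ℤ, ∃ d' ∈ D, b ∣ a - d')
    {x y : ℤ} (hx : x ∈ D) (hy : y ∈ D) (h : b ∣ x - y) : x = y := by
  have : NeZero b.natAbs := ⟨by omega⟩
  have key : ∀ z w : ℤ, (z : ZMod b.natAbs) = w ↔ b ∣ z - w := fun z w => by
    rw [← sub_eq_zero, ← Int.cast_sub, ZMod.intCast_zmod_eq_zero_iff_dvd, Int.natAbs_dvd]
  have himage : D.image (Int.cast : ℤ → ZMod b.natAbs) = Finset.univ := by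
    refine Finset.eq_univ_of_forall fun z => ?_
    obtain ⟨a, rfl⟩ := ZMod.intCast_surjective z
    obtain ⟨e, he, hae⟩ := hcover a
    exact Finset.mem_image.2 ⟨e, he, ((key a e).2 hae).symm⟩
  have hinj : Set.InjOn (Int.cast : ℤ → ZMod b.natAbs) D :=
    Finset.card_image_iff.1 (by rw [himage, Finset.card_univ, ZMod.card, hcard])
  exact hinj hx hy ((key x y).2 h)

/-- One digit of the expansion of `y + u * w`, where the word `w` records pending carries:
using the digit `d - u * b ^ k` in place of `d` creates a new carry. -/
theorem expandable_of_carry_step {b d u e y y' : ℤ} {D : Finset ℤ} {s : Bool} {t : List Bool}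
    (he : e ∈ D) (hstep : y + s.toInt * u = e + b * y')
    (h : Expandable b (insert (d - u * b ^ (t.length + 1)) (D.erase d))
      (y' + u * binaryValue b (t ++ [decide (e = d)]))) :
    Expandable b (insert (d - u * b ^ (t.length + 1)) (D.erase d))
      (y + u * binaryValue b (s :: t)) := by
  rw [binaryValue_append_singleton] at h
  rw [binaryValue]
  by_cases hed : e = d
  · subst hed
    convert Expandable.cons (Finset.mem_insert_self _ _) h using 1
    simp only [decide_true, Bool.toInt_true]
    linear_combination hstep
  · convert Expandable.cons
      (Finset.mem_insert_of_mem (Finset.mem_erase.2 ⟨hed, he⟩)) h using 1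
    simp only [hed, decide_false, Bool.toInt_false]
    linear_combination hstep

theorem replace_digit_positive_base
    (b : ℤ) (D : Finset ℤ) (hb : 3 ≤ b)
    (hcard : D.card = b.natAbs)
    (hcover : ∀ a : ℤ, ∃ d' ∈ D, b ∣ a - d')
    (hns : IsNumberSystem b D)
    (hsize : ∀ d' ∈ D, |d'| ≤ b)
    (d : ℤ) (hd : d ∈ D)
    (u : ℤ) (hu0 : u ≠ 0) (hu : |u| ≤ b - 1)
    (hu' : (0 : ℤ) ∉ D → |u| ≤ b - 2)
    (hbad : d ∉ badSet b D u) :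
    ∀ k : ℕ, 1 ≤ k → IsNumberSystem b (insert (d - u * b ^ k) (D.erase d)) := by
  intro k hk
  have hinj : ∀ x ∈ D, ∀ y ∈ D, b ∣ x - y → x = y := fun x hx y hy h =>
    eq_of_dvd_sub_of_cover (by omega) hcard hcover hx hy h
  have hdigit : ∀ a : ℤ, ∃ e ∈ D, ∃ y, a = e + b * y := fun a => by
    obtain ⟨e, he, y, hy⟩ := hcover a
    exact ⟨e, he, y, by linarith⟩
  have hO0 : Expandable b (D.erase d) 0 :=
    expandable_erase_of_notMem_badSet hns hbad (by simp)
  have hO : ∀ c : ℤ, |c| ≤ 1 → Expandable b (D.erase d) (c + u) := fun c hc => by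
    refine expandable_erase_of_notMem_badSet hns hbad ?_
    obtain ⟨h1, h2⟩ := abs_le.1 hc
    simp only [Set.mem_insert_iff, Set.mem_singleton_iff]
    omega
  have hOstep : ∀ x e y : ℤ, Expandable b (D.erase d) x → e ∈ D → x = e + b * y →
      e ≠ d ∧ Expandable b (D.erase d) y := by
    intro x e y hx he hxy
    obtain ⟨e', he', y', hxy', hy'⟩ := hx.exists_digit
    obtain ⟨hne, he'D⟩ := Finset.mem_erase.1 he'
    obtain rfl : e = e' := hinj e he e' he'D ⟨y' - y, by linear_combination hxy' - hxy⟩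
    obtain rfl : y = y' := mul_left_cancel₀ (show b ≠ 0 by omega) (by linarith)
    refine ⟨hne, ?_⟩
    rcases hy' with rfl | hy'
    · exact hO0
    · exact hy'
  have hsign : ∀ (y y' e : ℤ) (s : Bool), |y| ≤ 2 → e ∈ D → y + s.toInt * u = e + b * y' →
      2 ≤ |y'| → |y'| = 2 ∧ |y| = 2 ∧ s = true ∧ e ≠ d := by
    intro y y' e s hy he hstep hy'
    obtain ⟨hy1, hy2⟩ := abs_le.1 hy
    obtain ⟨he1, he2⟩ := abs_le.1 (hsize e he)
    obtain ⟨hu1, hu2⟩ := abs_le.1 hu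
    have hzero : (0 : ℤ) ∈ D ∨ (-(b - 2) ≤ u ∧ u ≤ b - 2) := by
      by_cases h0 : (0 : ℤ) ∈ D
      · exact Or.inl h0
      · exact Or.inr (abs_le.1 (hu' h0))
    rcases le_abs'.1 hy' with h | h
    · have hy'3 : -2 ≤ y' := by
        by_contra hlt
        have : b * y' ≤ b * (-3) := mul_le_mul_of_nonneg_left (by omega) (by omega)
        cases s <;> simp at hstep <;> linarith
      obtain rfl : y' = -2 := by omega
      cases s
      · simp at hstep; omega
      simp only [Bool.toInt_true, one_mul] at hstep
      refine ⟨rfl, ?_⟩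
      rcases hzero with h0 | h0
      · have heb : e ≠ b := fun heb =>
          absurd (hinj e he 0 h0 ⟨1, by linarith⟩) (by omega)
        obtain rfl : y = -2 := by omega
        have hb1 := (hOstep _ 0 (-1) (hO (-1) (by simp)) h0 (by omega)).2
        exact ⟨rfl, rfl, (hOstep _ e (-1) hb1 he (by omega)).1⟩
      · obtain rfl : y = -2 := by omega
        exact ⟨rfl, rfl, (hOstep 0 e (-1) hO0 he (by omega)).1⟩
    · have hy'3 : y' ≤ 2 := by
        by_contra hlt
        have : b * 3 ≤ b * y' := mul_le_mul_of_nonneg_left (by omega) (by omega)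
        cases s <;> simp at hstep <;> linarith
      obtain rfl : y' = 2 := by omega
      cases s
      · simp at hstep; omega
      simp only [Bool.toInt_true, one_mul] at hstep
      refine ⟨rfl, ?_⟩
      rcases hzero with h0 | h0
      · have heb : e ≠ -b := fun heb =>
          absurd (hinj e he 0 h0 ⟨-1, by linarith⟩) (by omega)
        obtain rfl : y = 2 := by omega
        have hb1 := (hOstep _ 0 1 (hO 1 (by simp)) h0 (by omega)).2
        exact ⟨rfl, rfl, (hOstep _ e 1 hb1 he (by omega)).1⟩
      · obtain rfl : y = 2 := by omega
        exact ⟨rfl, rfl, (hOstep 0 e 1 hO0 he (by omega)).1⟩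
  have hsmall : ∀ (y y' e : ℤ) (s : Bool), |y| ≤ 1 → e ∈ D → y + s.toInt * u = e + b * y' →
      |y'| ≤ 1 := by
    intro y y' e s hy he hstep
    by_contra hlt
    have := (hsign y y' e s (by omega) he hstep (by omega)).2.1
    omega
  have hlength : ∀ (L : List Bool), L.length = k → ∃ s t, L = s :: t ∧ k = t.length + 1 := by
    rintro (_ | ⟨s, t⟩) hL
    · simp at hL; omega
    · exact ⟨s, t, rfl, hL.symm⟩
  set D' := insert (d - u * b ^ k) (D.erase d) with hD'
  have hcarry : ∀ {y e y' : ℤ} {s : Bool} {t : List Bool}, k = t.length + 1 → e ∈ D →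
      y + s.toInt * u = e + b * y' →
      Expandable b D' (y' + u * binaryValue b (t ++ [decide (e = d)])) →
      Expandable b D' (y + u * binaryValue b (s :: t)) := by
    intro y e y' s t hkt he hstep h
    rw [hD', hkt] at h ⊢
    exact expandable_of_carry_step he hstep h
  -- Once `y` is expandable without `d`, no new carries appear.
  have hgood : ∀ (L : List Bool) (y : ℤ), |y| ≤ 1 → Expandable b (D.erase d) y →
      Expandable b D' (y + u * binaryValue b L) := by
    intro L
    induction L with
    | nil =>
      intro y _ hy
      simpa [binaryValue] using hy.mono (Finset.subset_insert _ _)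
    | cons s t ih =>
      intro y hy1 hy
      have hys : Expandable b (D.erase d) (y + s.toInt * u) := by
        cases s
        · simpa using hy
        · simpa using hO y hy1
      obtain ⟨e, he, y', hstep⟩ := hdigit (y + s.toInt * u)
      obtain ⟨hne, hy'⟩ := hOstep _ e y' hys he hstep
      have h := Expandable.cons (Finset.mem_insert_of_mem (Finset.mem_erase.2 ⟨hne, he⟩))
        (ih y' (hsmall y y' e s hy1 he hstep) hy')
      convert h using 1
      rw [binaryValue]
      linear_combination hstep
  -- With `|y| ≤ 1`, either a carry makes `y` expandable without `d`, or `y` reaches `0`.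
  have hone : ∀ (ℓ : ℕ) (f : ℕ → ℤ) (L : List Bool), (∀ i < ℓ, f i ∈ D) → L.length = k →
      |∑ i ∈ Finset.range ℓ, f i * b ^ i| ≤ 1 →
      Expandable b D' (∑ i ∈ Finset.range ℓ, f i * b ^ i + u * binaryValue b L) := by
    intro ℓ
    induction ℓ with
    | zero =>
      intro f L _ _ _
      exact hgood L _ (by simp) (by simpa using hO0)
    | succ ℓ ih =>
      intro f L hf hL hy
      obtain ⟨s, t, rfl, hkt⟩ := hlength L hL
      cases s
      · have hstep := sum_range_succ_mul_pow b f ℓ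
        have he := hf 0 (by omega)
        have hstep' : ∑ i ∈ Finset.range (ℓ + 1), f i * b ^ i + (false).toInt * u
            = f 0 + b * ∑ i ∈ Finset.range ℓ, f (i + 1) * b ^ i := by simpa using hstep
        exact hcarry hkt he hstep' (ih (fun i => f (i + 1)) _ (fun i hi => hf _ (by omega))
          (by simp [hkt]) (hsmall _ _ _ _ hy he hstep'))
      · obtain ⟨e, he, y', hstep⟩ :=
          hdigit (∑ i ∈ Finset.range (ℓ + 1), f i * b ^ i + (true).toInt * u)
        have hgy := (hOstep _ e y' (hO _ hy) he (by simpa using hstep)).2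
        exact hcarry hkt he hstep (hgood _ _ (hsmall _ _ _ _ hy he hstep) hgy)
  -- With `|y| ≤ 2`, staying at `|y| = 2` uses up a carry.
  have htwo : ∀ (m : ℕ) (y : ℤ) (L : List Bool), L.count true ≤ m → L.length = k → |y| ≤ 2 →
      Expandable b D' (y + u * binaryValue b L) := by
    intro m
    induction m with
    | zero =>
      intro y L hm hL hy
      obtain ⟨s, t, rfl, hkt⟩ := hlength L hL
      obtain ⟨e, he, y', hstep⟩ := hdigit (y + s.toInt * u)
      refine hcarry hkt he hstep ?_
      by_cases hy' : |y'| ≤ 1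
      · obtain ⟨ℓ, f, -, hf, rfl⟩ := hns y'
        exact hone ℓ f _ hf (by simp [hkt]) hy'
      · obtain ⟨-, -, rfl, -⟩ := hsign y y' e s hy he hstep (by omega)
        simp at hm
    | succ m ih =>
      intro y L hm hL hy
      obtain ⟨s, t, rfl, hkt⟩ := hlength L hL
      obtain ⟨e, he, y', hstep⟩ := hdigit (y + s.toInt * u)
      refine hcarry hkt he hstep ?_
      by_cases hy' : |y'| ≤ 1
      · obtain ⟨ℓ, f, -, hf, rfl⟩ := hns y'
        exact hone ℓ f _ hf (by simp [hkt]) hy'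
      · obtain ⟨h2, -, rfl, hne⟩ := hsign y y' e s hy he hstep (by omega)
        refine ih y' _ ?_ (by simp [hkt]) h2.le
        simpa [hne] using hm
  have hall : ∀ (n : ℕ) (y : ℤ) (L : List Bool), |y| ≤ n → L.length = k →
      Expandable b D' (y + u * binaryValue b L) := by
    intro n
    induction n with
    | zero => exact fun y L hy hL => htwo _ y L le_rfl hL (by simp at hy; simp [hy])
    | succ n ih =>
      intro y L hy hL
      by_cases hy2 : |y| ≤ 2
      · exact htwo _ y L le_rfl hL hy2
      obtain ⟨s, t, rfl, hkt⟩ := hlength L hL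
      obtain ⟨e, he, y', hstep⟩ := hdigit (y + s.toInt * u)
      refine hcarry hkt he hstep (ih y' _ ?_ (by simp [hkt]))
      by_contra hlt
      have hsu : |s.toInt * u| ≤ b - 1 := by
        cases s
        · simp; omega
        · simpa using hu
      have hby : b * |y'| ≤ |y| + (b - 1) + b := by
        have : b * y' = y + s.toInt * u - e := by linarith
        calc b * |y'| = |b * y'| := by rw [abs_mul, abs_of_pos (show 0 < b by omega)]
          _ ≤ |y| + |s.toInt * u| + |e| := by
            rw [this]; exact (abs_sub _ _).trans (by gcongr; exact abs_add_le _ _)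
          _ ≤ _ := by linarith [hsize e he]
      have hyy : |y| ≤ |y'| := by push_cast at hy; omega
      nlinarith
  intro a
  change Expandable b D' a
  simpa [binaryValue_replicate_false] using
    hall a.natAbs a (List.replicate k false) (by simp) (by simp)
end

section
/- Let d, D ∈ ℤ with d < D. Then (ℤ, −2, {d, D}) is a number system if and only if all of the following hold: (i) exactly one of d, D is even; (ii) 3 ∤ d or d = 0, and 3 ∤ D or D = 0 (i.e., neither digit is divisible by 3, except that the even digit may be 0); (iii) 2d ≤ D and d ≤ 2D; (iv) D − d = 3^i for some integer i ≥ 0. -/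
/-- The backward division map of base `-2` with digits `d` and `D`: it removes the lowest digit. -/
def negTwoStep (d D a : ℤ) : ℤ := if Even (d - a) then (d - a) / 2 else (D - a) / 2

/-- The distance of `3 * a` from the attracting interval `[2 * d - D, 2 * D - d]`, with sign. -/
def attractorGap (d D a : ℤ) : ℤ := max (3 * a - (2 * D - d)) ((2 * d - D) - 3 * a)

lemma two_mul_negTwoStep {d D : ℤ} (h : Odd (D - d)) (a : ℤ) :
    2 * negTwoStep d D a = d - a ∨ 2 * negTwoStep d D a = D - a := by
  unfold negTwoStep
  obtain ⟨k, hk⟩ := h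
  split_ifs with h1
  · obtain ⟨m, hm⟩ := h1
    omega
  · rw [Int.not_even_iff_odd] at h1
    obtain ⟨m, hm⟩ := h1
    omega

lemma negTwoStep_iterate_eq_zero {d D : ℤ} (h : Odd (D - d)) (ℓ : ℕ) (f : ℕ → ℤ)
    (hf : ∀ i < ℓ, f i = d ∨ f i = D) :
    (negTwoStep d D)^[ℓ] (∑ i ∈ Finset.range ℓ, f i * (-2) ^ i) = 0 := by
  induction ℓ generalizing f with
  | zero => simp
  | succ n ih =>
    have hsum : ∑ i ∈ Finset.range (n + 1), f i * (-2) ^ i =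
        f 0 - 2 * ∑ i ∈ Finset.range n, f (i + 1) * (-2) ^ i := by
      rw [Finset.sum_range_succ', Finset.mul_sum, sub_eq_add_neg, ← Finset.sum_neg_distrib,
        add_comm]
      congr 1
      · simp
      · exact Finset.sum_congr rfl fun i _ => by ring
    have hstep : negTwoStep d D (∑ i ∈ Finset.range (n + 1), f i * (-2) ^ i) =
        ∑ i ∈ Finset.range n, f (i + 1) * (-2) ^ i := by
      have h2 := two_mul_negTwoStep h (∑ i ∈ Finset.range (n + 1), f i * (-2) ^ i)
      have h0 := hf 0 (by omega)
      obtain ⟨k, hk⟩ := h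
      omega
    rw [Function.iterate_succ_apply, hstep]
    exact ih (fun i => f (i + 1)) fun i hi => hf (i + 1) (by omega)

lemma isExpansion_of_negTwoStep_iterate_eq_zero {d D : ℤ} (h : Odd (D - d)) {a : ℤ} {ℓ : ℕ}
    (hℓ : 1 ≤ ℓ) (h0 : (negTwoStep d D)^[ℓ] a = 0) :
    IsExpansion (-2) {d, D} a ℓ
      (fun i => (negTwoStep d D)^[i] a + 2 * (negTwoStep d D)^[i + 1] a) := by
  refine ⟨hℓ, fun i _ => ?_, ?_⟩
  · have := two_mul_negTwoStep h ((negTwoStep d D)^[i] a)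
    simp only [Function.iterate_succ_apply', Finset.mem_insert, Finset.mem_singleton]
    omega
  · have htel := Finset.sum_range_sub' (fun i => (negTwoStep d D)^[i] a * (-2) ^ i) ℓ
    simp only [h0, zero_mul, sub_zero, Function.iterate_zero, id, pow_zero, mul_one] at htel
    refine htel.symm.trans ?_
    exact Finset.sum_congr rfl fun i _ => by ring

lemma isNumberSystem_neg_two_iff {d D : ℤ} (h : Odd (D - d)) :
    IsNumberSystem (-2) {d, D} ↔ ∀ a, ∃ ℓ, 1 ≤ ℓ ∧ (negTwoStep d D)^[ℓ] a = 0 := by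
  refine forall_congr' fun a => ⟨?_, ?_⟩
  · rintro ⟨ℓ, f, hℓ, hf, rfl⟩
    exact ⟨ℓ, hℓ, negTwoStep_iterate_eq_zero h ℓ f fun i hi => by simpa using hf i hi⟩
  · rintro ⟨ℓ, hℓ, h0⟩
    exact ⟨ℓ, _, isExpansion_of_negTwoStep_iterate_eq_zero h hℓ h0⟩

lemma IsNumberSystem.odd_sub {d D : ℤ} (h : IsNumberSystem (-2) {d, D}) : Odd (D - d) := by
  have key : ∀ a : ℤ, ∃ e ∈ ({d, D} : Finset ℤ), (2 : ℤ) ∣ a - e := by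
    intro a
    obtain ⟨ℓ, f, hℓ, hf, ha⟩ := h a
    obtain ⟨n, rfl⟩ := Nat.exists_eq_add_of_le' hℓ
    refine ⟨f 0, hf 0 (by omega), ?_⟩
    rw [ha, Finset.sum_range_succ']
    simp only [pow_zero, mul_one, add_sub_cancel_right]
    exact Finset.dvd_sum fun i _ => ⟨-(f (i + 1) * (-2) ^ i), by ring⟩
  obtain ⟨e, he, hev⟩ := key 0
  obtain ⟨e', he', hodd⟩ := key 1
  simp only [Finset.mem_insert, Finset.mem_singleton] at he he'
  rw [Int.odd_iff]
  omega

lemma two_mul_attractorGap_negTwoStep_le {d D : ℤ} (h : Odd (D - d)) (hdD : d < D) (a : ℤ) :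
    2 * attractorGap d D (negTwoStep d D a) ≤ attractorGap d D a := by
  have := two_mul_negTwoStep h a
  unfold attractorGap
  omega

lemma attractorGap_iterate_le_zero {d D : ℤ} (h : Odd (D - d)) (hdD : d < D) {a : ℤ}
    (ha : attractorGap d D a ≤ 0) (k : ℕ) : attractorGap d D ((negTwoStep d D)^[k] a) ≤ 0 := by
  induction k with
  | zero => exact ha
  | succ n ih =>
    rw [Function.iterate_succ_apply']
    have := two_mul_attractorGap_negTwoStep_le h hdD ((negTwoStep d D)^[n] a)
    omega

lemma two_pow_mul_attractorGap_iterate_le {d D : ℤ} (h : Odd (D - d)) (hdD : d < D) (a : ℤ)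
    (k : ℕ) : 2 ^ k * attractorGap d D ((negTwoStep d D)^[k] a) ≤ attractorGap d D a := by
  induction k with
  | zero => simp
  | succ n ih =>
    rw [Function.iterate_succ_apply', pow_succ, mul_assoc]
    exact (mul_le_mul_of_nonneg_left (two_mul_attractorGap_negTwoStep_le h hdD _)
      (by positivity)).trans ih

lemma exists_attractorGap_iterate_le_zero {d D : ℤ} (h : Odd (D - d)) (hdD : d < D) (a : ℤ) :
    ∃ k, attractorGap d D ((negTwoStep d D)^[k] a) ≤ 0 := by
  by_contra! hpos
  have hk := two_pow_mul_attractorGap_iterate_le h hdD a (attractorGap d D a).toNat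
  have hlt : ((attractorGap d D a).toNat : ℤ) < 2 ^ (attractorGap d D a).toNat := by
    exact_mod_cast Nat.lt_two_pow_self
  have := hpos (attractorGap d D a).toNat
  have hself := Int.self_le_toNat (attractorGap d D a)
  nlinarith

/-- A property invariant under the step map holds for all integers or for none, as soon as every
orbit reaches `0`. -/
lemma iff_zero_of_negTwoStep_invariant {d D : ℤ}
    (hT : ∀ a, ∃ ℓ, 1 ≤ ℓ ∧ (negTwoStep d D)^[ℓ] a = 0) (P : ℤ → Prop)
    (hP : ∀ a, P (negTwoStep d D a) ↔ P a) (a : ℤ) : P a ↔ P 0 := by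
  obtain ⟨ℓ, -, hℓ⟩ := hT a
  have hiter : ∀ k, P ((negTwoStep d D)^[k] a) ↔ P a := by
    intro k
    induction k with
    | zero => rfl
    | succ n ih => rw [Function.iterate_succ_apply', hP, ih]
  rw [← hℓ, hiter]

lemma eq_three_of_prime_dvd_sub {d D : ℤ} (h : Odd (D - d))
    (hT : ∀ a, ∃ ℓ, 1 ≤ ℓ ∧ (negTwoStep d D)^[ℓ] a = 0) {p : ℕ} (hp : p.Prime)
    (hpN : (p : ℤ) ∣ D - d) : p = 3 := by
  by_contra hp3
  have hpZ : Prime (p : ℤ) := Nat.prime_iff_prime_int.mp hp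
  have hp2 : ¬ (p : ℤ) ∣ 2 := by
    intro h2
    have : p = 2 := (Nat.prime_dvd_prime_iff_eq hp Nat.prime_two).mp (by exact_mod_cast h2)
    subst this
    obtain ⟨k, hk⟩ := h
    omega
  have hp3' : ¬ (p : ℤ) ∣ 3 := fun h3 =>
    hp3 ((Nat.prime_dvd_prime_iff_eq hp Nat.prime_three).mp (by exact_mod_cast h3))
  have hinv : ∀ a, (p : ℤ) ∣ 3 * negTwoStep d D a - d ↔ (p : ℤ) ∣ 3 * a - d := by
    intro a
    have hmul : (p : ℤ) ∣ 2 * (3 * negTwoStep d D a - d) ↔ (p : ℤ) ∣ 3 * a - d := by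
      rcases two_mul_negTwoStep h a with h2 | h2
      · rw [show 2 * (3 * negTwoStep d D a - d) = -(3 * a - d) by linarith, dvd_neg]
      · rw [show 2 * (3 * negTwoStep d D a - d) = 3 * (D - d) - (3 * a - d) by linarith]
        exact dvd_sub_right (hpN.mul_left 3)
    rw [← hmul, hpZ.dvd_mul]
    tauto
  have hconst := iff_zero_of_negTwoStep_invariant hT (fun a => (p : ℤ) ∣ 3 * a - d) hinv
  have hcop : IsCoprime (3 : ℤ) p := ((hpZ.coprime_iff_not_dvd).mpr hp3').symm
  obtain ⟨u, v, huv⟩ := hcop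
  have hfix : (p : ℤ) ∣ 3 * (u * d) - d := ⟨-(v * d), by linear_combination d * huv⟩
  have hnext : (p : ℤ) ∣ 3 * (u * d + 1) - d := (hconst _).mpr ((hconst _).mp hfix)
  exact hp3' (by simpa [mul_add, add_sub_right_comm] using (dvd_sub hnext hfix))

lemma exists_neg_two_pow_three_pow_eq (n : ℕ) :
    ∃ m : ℤ, ¬ 3 ∣ m ∧ (-2 : ℤ) ^ 3 ^ n = 1 + 3 ^ (n + 1) * m := by
  induction n with
  | zero => exact ⟨-1, by decide, by norm_num⟩
  | succ n ih =>
    obtain ⟨m, hm, hpow⟩ := ih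
    refine ⟨m + 3 * (3 ^ n * m ^ 2 + 3 ^ n * 3 ^ n * m ^ 3), by omega, ?_⟩
    rw [pow_succ 3 n, pow_mul, hpow]
    ring

/-- `-2` generates the group of residues modulo `3 ^ (n + 1)` that are `1` modulo `3`. -/
lemma exists_dvd_neg_two_pow_mul_sub (n : ℕ) {u v : ℤ} (hv : ¬ 3 ∣ v) (huv : (3 : ℤ) ∣ v - u) :
    ∃ k : ℕ, 1 ≤ k ∧ (3 : ℤ) ^ (n + 1) ∣ (-2) ^ k * v - u := by
  induction n with
  | zero => exact ⟨1, le_rfl, by omega⟩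
  | succ n ih =>
    obtain ⟨k, hk, c, hc⟩ := ih
    obtain ⟨m, hm, hpow⟩ := exists_neg_two_pow_three_pow_eq n
    set w := (-2 : ℤ) ^ k * v with hw
    have hw3 : ¬ (3 : ℤ) ∣ w := by
      rw [hw, Int.prime_three.dvd_mul]
      rintro (h | h)
      · exact absurd (Int.prime_three.dvd_of_dvd_pow h) (by decide)
      · exact hv h
    have hmw : ¬ (3 : ℤ) ∣ m * w := by
      rw [Int.prime_three.dvd_mul]
      tauto
    have hcases : (3 : ℤ) ∣ c ∨ (3 : ℤ) ∣ c + m * w ∨ (3 : ℤ) ∣ c + 2 * (m * w) := by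
      rcases (by omega : c % 3 = 0 ∨ c % 3 = 1 ∨ c % 3 = 2) with h | h | h <;>
      rcases (by omega : m * w % 3 = 1 ∨ m * w % 3 = 2) with h' | h' <;> omega
    rcases hcases with ⟨q, hq⟩ | ⟨q, hq⟩ | ⟨q, hq⟩
    · exact ⟨k, hk, q, by rw [hc, hq]; ring⟩
    · refine ⟨k + 3 ^ n, hk.trans (Nat.le_add_right _ _), q, ?_⟩
      rw [pow_add, hpow]
      linear_combination hc + 3 ^ (n + 1) * hq + (1 + 3 ^ (n + 1) * m) * hw
    · refine ⟨k + 3 ^ n * 2, hk.trans (Nat.le_add_right _ _), q + 3 ^ n * m ^ 2 * w, ?_⟩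
      rw [pow_add, pow_mul, hpow]
      linear_combination hc + 3 ^ (n + 1) * hq + (1 + 3 ^ (n + 1) * m) ^ 2 * hw

lemma dvd_neg_two_pow_mul_iterate_sub {d D : ℤ} (h : Odd (D - d)) (a : ℤ) (k : ℕ) :
    3 * (D - d) ∣ (-2) ^ k * (3 * (negTwoStep d D)^[k] a - d) - (3 * a - d) := by
  induction k with
  | zero => simp
  | succ n ih =>
    rw [Function.iterate_succ_apply']
    set b := (negTwoStep d D)^[n] a
    rcases two_mul_negTwoStep h b with h2 | h2
    · rwa [show (-2) ^ (n + 1) * (3 * negTwoStep d D b - d) - (3 * a - d) =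
          (-2) ^ n * (3 * b - d) - (3 * a - d) by linear_combination (-3) * (-2) ^ n * h2]
    · rw [show (-2) ^ (n + 1) * (3 * negTwoStep d D b - d) - (3 * a - d) =
          ((-2) ^ n * (3 * b - d) - (3 * a - d)) - (-2) ^ n * (3 * (D - d)) by
        linear_combination (-3) * (-2) ^ n * h2]
      exact dvd_sub ih (dvd_mul_left _ _)

lemma exists_iterate_eq_zero_of_sub_eq_three_pow {d D : ℤ} (h : Odd (D - d)) (hdD : d < D)
    (hd : ¬ 3 ∣ d) (h1 : 2 * d ≤ D) (h2 : d ≤ 2 * D) {i : ℕ} (hi : D - d = 3 ^ (i + 1)) {a : ℤ}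
    (ha : attractorGap d D a ≤ 0) : ∃ k, 1 ≤ k ∧ (negTwoStep d D)^[k] a = 0 := by
  obtain ⟨k, hk, hdvd⟩ := exists_dvd_neg_two_pow_mul_sub (i + 1) (u := 3 * a - d) (v := -d)
    (by omega) (by omega)
  refine ⟨k, hk, ?_⟩
  have hiter := dvd_neg_two_pow_mul_iterate_sub h a k
  have hgap := attractorGap_iterate_le_zero h hdD ha k
  set x := (negTwoStep d D)^[k] a
  have hN : 3 * (D - d) = 3 ^ (i + 1 + 1) := by rw [hi]; ring
  rw [← hN] at hdvd
  have hx : 3 * (D - d) ∣ 3 * ((-2) ^ k * x) := by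
    rw [show 3 * ((-2) ^ k * x) = ((-2) ^ k * (3 * x - d) - (3 * a - d)) -
      ((-2) ^ k * -d - (3 * a - d)) by ring]
    exact dvd_sub hiter hdvd
  have hx' : D - d ∣ (-2) ^ k * x := (mul_dvd_mul_iff_left (by norm_num)).mp hx
  have hcop : IsCoprime (D - d) ((-2) ^ k) := by
    refine IsCoprime.pow_right ?_
    obtain ⟨m, hm⟩ := h
    exact ⟨1, m, by linarith⟩
  have hdx := hcop.dvd_of_dvd_mul_left hx'
  have h3N : (3 : ℤ) ∣ D - d := hi ▸ dvd_pow_self 3 (by omega)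
  refine Int.eq_zero_of_abs_lt_dvd hdx ?_
  unfold attractorGap at hgap
  rw [abs_lt]
  omega

lemma exists_iterate_eq_zero_of_sub_eq_one {d D : ℤ} (hN : D - d = 1)
    (h1 : 2 * d ≤ D) (h2 : d ≤ 2 * D) {a : ℤ} (ha : attractorGap d D a ≤ 0) :
    ∃ k, 1 ≤ k ∧ (negTwoStep d D)^[k] a = 0 := by
  have hodd : Odd (D - d) := hN ▸ odd_one
  have hfirst := two_mul_negTwoStep hodd a
  have hsecond := two_mul_negTwoStep hodd (negTwoStep d D a)
  unfold attractorGap at ha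
  by_cases h0 : negTwoStep d D a = 0
  · exact ⟨1, le_rfl, h0⟩
  · refine ⟨2, by norm_num, ?_⟩
    change negTwoStep d D (negTwoStep d D a) = 0
    omega

/-- Characterisation of all valid digit sets for base `-2`. -/
theorem base_neg_two_characterisation (d D : ℤ) (hdD : d < D) :
    IsNumberSystem (-2) {d, D} ↔
      (((Even d ∧ Odd D) ∨ (Odd d ∧ Even D)) ∧
       ((¬ (3 ∣ d) ∨ d = 0) ∧ (¬ (3 ∣ D) ∨ D = 0)) ∧
       (2 * d ≤ D ∧ d ≤ 2 * D) ∧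
       (∃ i : ℕ, D - d = 3 ^ i)) := by
  constructor
  · intro hns
    have hodd := hns.odd_sub
    have hT := (isNumberSystem_neg_two_iff hodd).mp hns
    have hbound : 2 * d ≤ D ∧ d ≤ 2 * D := by
      obtain ⟨ℓ, hℓ, h0⟩ := hT 0
      have hle := two_pow_mul_attractorGap_iterate_le hodd hdD 0 ℓ
      rw [h0] at hle
      have hpow : (2 : ℤ) ≤ 2 ^ ℓ := le_self_pow₀ (by norm_num) (by omega)
      have hgap : attractorGap d D 0 ≤ 0 := by
        by_contra! hpos
        nlinarith
      unfold attractorGap at hgap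
      omega
    have hthree : ∃ i : ℕ, D - d = 3 ^ i := by
      have hcast : ((D - d).toNat : ℤ) = D - d := Int.toNat_of_nonneg (by omega)
      refine ⟨(D - d).toNat.primeFactorsList.length, ?_⟩
      rw [← hcast]
      exact_mod_cast Nat.eq_prime_pow_of_unique_prime_dvd (by omega) fun {p} hp hdvd =>
        eq_three_of_prime_dvd_sub hodd hT hp (by rw [← hcast]; exact_mod_cast hdvd)
    refine ⟨?_, ?_, hbound, hthree⟩
    · rw [Int.odd_iff] at hodd
      simp only [Int.even_iff, Int.odd_iff]
      omega
    · obtain ⟨i, hi⟩ := hthree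
      rcases i with _ | i
      · rw [pow_zero] at hi
        omega
      · have h3N : (3 : ℤ) ∣ D - d := hi ▸ dvd_pow_self 3 (by omega)
        have hd : ¬ 3 ∣ d := by
          intro hd
          have hone := iff_zero_of_negTwoStep_invariant hT (fun a => (3 : ℤ) ∣ a)
            (fun a => by have := two_mul_negTwoStep hodd a; omega) 1
          omega
        omega
  · rintro ⟨hpar, ⟨hd, hD⟩, ⟨h1, h2⟩, i, hi⟩
    have hodd : Odd (D - d) := by
      simp only [Int.even_iff, Int.odd_iff] at hpar ⊢
      omega
    rw [isNumberSystem_neg_two_iff hodd]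
    intro a
    obtain ⟨k, hk⟩ := exists_attractorGap_iterate_le_zero hodd hdD a
    have hreach : ∃ l, 1 ≤ l ∧ (negTwoStep d D)^[l] ((negTwoStep d D)^[k] a) = 0 := by
      rcases i with _ | i
      · exact exists_iterate_eq_zero_of_sub_eq_one (by simpa using hi) h1 h2 hk
      · have h3N : (3 : ℤ) ∣ D - d := hi ▸ dvd_pow_self 3 (by omega)
        exact exists_iterate_eq_zero_of_sub_eq_three_pow hodd hdD (by omega) h1 h2 hi hk
    obtain ⟨l, hl, h0⟩ := hreach
    exact ⟨l + k, by omega, by rwa [Function.iterate_add_apply]⟩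
end

section
/- Let (ℤ, −2, {d, D}) be a pre-number system (so exactly one of d, D is even) with d < D, and let 𝒜 be its attractor. Then 𝒜 is the integer interval 𝒜 = {a ∈ ℤ : 2d − D ≤ 3a and 3a ≤ 2D − d}, i.e., 𝒜 = {⌈(2d − D)/3⌉, …, ⌊(2D − d)/3⌋}. -/
/-- A point of a finite set on which `f` is a surjective self-map is periodic. -/
theorem exists_iterate_eq_of_surjOn {α : Type*} {f : α → α} {s : Set α} (hs : s.Finite)
    (hmaps : Set.MapsTo f s s) (hsurj : Set.SurjOn f s s) {a : α} (ha : a ∈ s) :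
    ∃ n : ℕ, 1 ≤ n ∧ f^[n] a = a := by
  have : Finite s := hs
  have hinj : Function.Injective (hmaps.restrict f s s) :=
    Finite.injective_iff_surjective.2 (hmaps.restrict_surjective_iff.2 hsurj)
  obtain ⟨n, hn, hper⟩ := hinj.mem_periodicPts ⟨a, ha⟩
  refine ⟨n, hn, ?_⟩
  have h := congrArg Subtype.val hper.eq
  rwa [hmaps.iterate_restrict] at h

/-- A periodic point of `f` lies in `s` if a natural number valued function strictly decreases
along `f` outside `s` and `s` is mapped to itself. -/
theorem mem_of_iterate_eq {α : Type*} {f : α → α} {s : Set α} (hmaps : Set.MapsTo f s s)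
    (g : α → ℕ) (hg : ∀ a, a ∉ s → g (f a) < g a) {a : α} {n : ℕ} (hn : 1 ≤ n)
    (h : f^[n] a = a) : a ∈ s := by
  have key : ∀ k : ℕ, f^[k + 1] a ∈ s ∨ g (f^[k + 1] a) < g a := by
    intro k
    induction k with
    | zero =>
      by_cases ha : a ∈ s
      · exact Or.inl (hmaps ha)
      · exact Or.inr (hg a ha)
    | succ k ih =>
      rw [Function.iterate_succ_apply']
      by_cases hk : f^[k + 1] a ∈ s
      · exact Or.inl (hmaps hk)
      · exact Or.inr ((hg _ hk).trans (ih.resolve_left hk))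
  obtain ⟨k, rfl⟩ : ∃ k, n = k + 1 := ⟨n - 1, by omega⟩
  have hk := key k
  rw [h] at hk
  exact hk.resolve_right (lt_irrefl _)

/-- For base `-2` with digits `{d, D}`, the attractor is the integer interval
`{⌈(2d − D)/3⌉, …, ⌊(2D − d)/3⌋}`. -/
theorem base_neg_two_attractor_is_interval
    (d D : ℤ) (hdD : d < D)
    (hpar : (Even d ∧ Odd D) ∨ (Odd d ∧ Even D))
    (dig : ℤ → ℤ)
    (hdig : ∀ a : ℤ, dig a ∈ ({d, D} : Set ℤ) ∧ (-2 : ℤ) ∣ a - dig a)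
    (T : ℤ → ℤ) (hT : ∀ a : ℤ, (-2 : ℤ) * T a = a - dig a) :
    attractor T = {a : ℤ | 2 * d - D ≤ 3 * a ∧ 3 * a ≤ 2 * D - d} := by
  have hdigit : ∀ a, dig a = d ∨ dig a = D := fun a => by simpa using (hdig a).1
  have hmaps : Set.MapsTo T {a : ℤ | 2 * d - D ≤ 3 * a ∧ 3 * a ≤ 2 * D - d}
      {a : ℤ | 2 * d - D ≤ 3 * a ∧ 3 * a ≤ 2 * D - d} := by
    rintro a ⟨h₁, h₂⟩
    have h := hT a
    rcases hdigit a with h' | h' <;> constructor <;> omega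
  ext a
  constructor
  · rintro ⟨n, hn, h⟩
    refine mem_of_iterate_eq hmaps
      (fun a => (max (3 * a - (2 * D - d)) (2 * d - D - 3 * a)).toNat) ?_ hn h
    intro a ha
    have h := hT a
    simp only [Set.mem_ofPred_eq, not_and_or, not_le] at ha
    rcases hdigit a with h' | h' <;> omega
  · refine exists_iterate_eq_of_surjOn ?_ hmaps ?_
    · refine (Set.finite_Icc (-(|d| + |D|)) (|d| + |D|)).subset ?_
      rintro a ⟨h₁, h₂⟩
      rw [Set.mem_Icc]
      constructor <;> grind
    · rintro b ⟨h₁, h₂⟩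
      have hpar' : d % 2 ≠ D % 2 := by
        simp only [Int.even_iff, Int.odd_iff] at hpar
        omega
      have hpre : ∀ x, x = d ∨ x = D → T (x - 2 * b) = b := by
        intro x hx
        have h := hT (x - 2 * b)
        rcases hx with rfl | rfl <;> rcases hdigit (_ - 2 * b) with h' | h' <;>
          rw [h'] at h <;> omega
      rcases le_total (6 * b) (d + D) with h | h
      · exact ⟨d - 2 * b, ⟨by omega, by omega⟩, hpre d (Or.inl rfl)⟩
      · exact ⟨D - 2 * b, ⟨by omega, by omega⟩, hpre D (Or.inr rfl)⟩
end
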